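/- arXiv:1607.04095 — 3 statements merged into one kernel-verified Lean document; each statement's English description precedes it below -/
import Mathlib

section
/- Let w be a Schwartz function on ℝ². Then for all nonnegative integers m, n, h, k one has M₁^m M₂^n D₁^h D₂^k Wig[w] = Wig[ 2^{−(n+m)} (M₂+M₁)^m (D₁−D₂)^n (M₂−M₁)^k (D₁+D₂)^h w ]. Consequently, for every linear partial differential operator with polynomial coefficients P(M₁,M₂,D₁,D₂) (a finite sum Σ c_{mnhk} M₁^m M₂^n D₁^h D₂^k with complex coefficients), P(M₁,M₂,D₁,D₂) Wig[w] = Wig[ P( (M₂+M₁)/2, (D₁−D₂)/2, D₁+D₂, M₂−M₁ ) w ]. -/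
/-!
STATEMENT 1. For `w ∈ 𝓢(ℝ², ℂ)` and all `m, n, h, k ∈ ℕ`,
`M₁^m M₂^n D₁^h D₂^k Wig[w] = Wig[2^{-(n+m)} (M₂+M₁)^m (D₁-D₂)^n (M₂-M₁)^k (D₁+D₂)^h w]`,
and consequently for every linear partial differential operator with polynomial coefficients
`P(M₁,M₂,D₁,D₂) = Σ c_{mnhk} M₁^m M₂^n D₁^h D₂^k`,
`P(M₁,M₂,D₁,D₂) Wig[w] = Wig[P((M₂+M₁)/2, (D₁-D₂)/2, D₁+D₂, M₂-M₁) w]`.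
-/

noncomputable section
open MeasureTheory Complex SchwartzMap

abbrev Fn2 := ℝ × ℝ → ℂ

def M1 : Fn2 → Fn2 := fun f p => p.1 * f p
def M2 : Fn2 → Fn2 := fun f p => p.2 * f p
def D1 : Fn2 → Fn2 := fun f p => -Complex.I * fderiv ℝ f p (1, 0)
def D2 : Fn2 → Fn2 := fun f p => -Complex.I * fderiv ℝ f p (0, 1)

/-- The Wigner-like transform `Wig[w](x,y) = ∫ e^{-ity} w(x + t/2, x - t/2) dt`. -/
def Wig (w : Fn2) : Fn2 :=
  fun p => ∫ t : ℝ, Complex.exp (-Complex.I * t * p.2) * w (p.1 + t / 2, p.1 - t / 2)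

namespace SchwartzMap

/-- Multiplication by the first variable on `𝓢(ℝ × ℝ, ℂ)`. -/
def mulFst : 𝓢(ℝ × ℝ, ℂ) →L[ℂ] 𝓢(ℝ × ℝ, ℂ) := smulLeftCLM ℂ fun p : ℝ × ℝ => (p.1 : ℂ)

/-- Multiplication by the second variable on `𝓢(ℝ × ℝ, ℂ)`. -/
def mulSnd : 𝓢(ℝ × ℝ, ℂ) →L[ℂ] 𝓢(ℝ × ℝ, ℂ) := smulLeftCLM ℂ fun p : ℝ × ℝ => (p.2 : ℂ)

/-- The operator `-i ∂_v` on `𝓢(ℝ × ℝ, ℂ)`. -/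
def dirD (v : ℝ × ℝ) : 𝓢(ℝ × ℝ, ℂ) →L[ℂ] 𝓢(ℝ × ℝ, ℂ) :=
  (-Complex.I) • LineDeriv.lineDerivOpCLM ℂ 𝓢(ℝ × ℝ, ℂ) v

theorem mulFst_apply (w : 𝓢(ℝ × ℝ, ℂ)) (p : ℝ × ℝ) : mulFst w p = p.1 * w p :=
  smulLeftCLM_apply_apply
    ((Complex.ofRealCLM.comp (ContinuousLinearMap.fst ℝ ℝ ℝ)).hasTemperateGrowth) w p

theorem mulSnd_apply (w : 𝓢(ℝ × ℝ, ℂ)) (p : ℝ × ℝ) : mulSnd w p = p.2 * w p :=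
  smulLeftCLM_apply_apply
    ((Complex.ofRealCLM.comp (ContinuousLinearMap.snd ℝ ℝ ℝ)).hasTemperateGrowth) w p

theorem dirD_apply (v : ℝ × ℝ) (w : 𝓢(ℝ × ℝ, ℂ)) (p : ℝ × ℝ) :
    dirD v w p = -Complex.I * fderiv ℝ w p v := rfl

theorem coe_mulSnd_add_mulFst (w : 𝓢(ℝ × ℝ, ℂ)) : ⇑((mulSnd + mulFst) w) = (M2 + M1) w := by
  ext p; simp [mulFst_apply, mulSnd_apply, M1, M2]

theorem coe_mulSnd_sub_mulFst (w : 𝓢(ℝ × ℝ, ℂ)) : ⇑((mulSnd - mulFst) w) = (M2 - M1) w := by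
  ext p; simp [mulFst_apply, mulSnd_apply, M1, M2]

theorem coe_dirD_add_dirD (w : 𝓢(ℝ × ℝ, ℂ)) :
    ⇑((dirD (1, 0) + dirD (0, 1)) w) = (D1 + D2) w := by
  ext p; simp [dirD_apply, D1, D2]

theorem coe_dirD_sub_dirD (w : 𝓢(ℝ × ℝ, ℂ)) :
    ⇑((dirD (1, 0) - dirD (0, 1)) w) = (D1 - D2) w := by
  ext p; simp [dirD_apply, D1, D2]

theorem commute_dirD_add_mulSnd_sub :
    Commute (dirD (1, 0) + dirD (0, 1)) (mulSnd - mulFst) := by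
  ext w p
  have hg : HasFDerivAt (fun q : ℝ × ℝ => ((q.2 : ℂ) - q.1))
      (Complex.ofRealCLM.comp (ContinuousLinearMap.snd ℝ ℝ ℝ) -
        Complex.ofRealCLM.comp (ContinuousLinearMap.fst ℝ ℝ ℝ)) p :=
    (Complex.ofRealCLM.comp (ContinuousLinearMap.snd ℝ ℝ ℝ) -
        Complex.ofRealCLM.comp (ContinuousLinearMap.fst ℝ ℝ ℝ)).hasFDerivAt
  have hw : ⇑((mulSnd - mulFst) w) = fun q : ℝ × ℝ => ((q.2 : ℂ) - q.1) * w q := by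
    ext q; simp [mulFst_apply, mulSnd_apply, sub_mul]
  have hd := (hg.mul w.differentiableAt.hasFDerivAt).fderiv
  simp only [mul_apply_eq_comp, add_apply, dirD_apply]
  rw [hw]
  erw [hd]
  simp [mulFst_apply, mulSnd_apply, dirD_apply]
  ring

/-- A Schwartz function is uniformly `O((1 + |t|)⁻³)` along the antidiagonal lines
`t ↦ (x + t/2, x - t/2)`. -/
theorem exists_antidiagonal_bound {F : Type*} [NormedAddCommGroup F] [NormedSpace ℝ F]
    (v : 𝓢(ℝ × ℝ, F)) :
    ∃ C : ℝ, ∀ x t : ℝ, (1 + |t|) * ‖v (x + t / 2, x - t / 2)‖ ≤ C * (1 + ‖t‖) ^ (-2 : ℝ) := by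
  obtain ⟨C, hC⟩ : ∃ C, ∀ q, (1 + ‖q‖) ^ 3 * ‖v q‖ ≤ C := ⟨_, fun q => by
    simpa only [norm_iteratedFDeriv_zero] using
      one_add_le_sup_seminorm_apply (𝕜 := ℝ) (m := (3, 0)) (k := 3) (n := 0) le_rfl le_rfl v q⟩
  refine ⟨8 * C, fun x t => ?_⟩
  set q : ℝ × ℝ := (x + t / 2, x - t / 2)
  have h1 : |x + t / 2| ≤ ‖q‖ := norm_fst_le q
  have h2 : |x - t / 2| ≤ ‖q‖ := norm_snd_le q
  have ht : |t| ≤ 2 * ‖q‖ := by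
    rw [abs_le] at *
    constructor <;> linarith
  have hpow : (1 + |t|) ^ 3 ≤ 8 * (1 + ‖q‖) ^ 3 := by
    calc (1 + |t|) ^ 3 ≤ (2 * (1 + ‖q‖)) ^ 3 := by gcongr; linarith
      _ = _ := by ring
  rw [Real.rpow_neg (by positivity), Real.norm_eq_abs, ← div_eq_mul_inv,
    le_div_iff₀ (by positivity)]
  norm_cast
  calc (1 + |t|) * ‖v q‖ * (1 + |t|) ^ 2 = (1 + |t|) ^ 3 * ‖v q‖ := by ring
    _ ≤ 8 * (1 + ‖q‖) ^ 3 * ‖v q‖ := by gcongr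
    _ = 8 * ((1 + ‖q‖) ^ 3 * ‖v q‖) := by ring
    _ ≤ _ := mul_le_mul_of_nonneg_left (hC q) (by norm_num)

end SchwartzMap

theorem integrable_const_mul_one_add_norm_rpow (C : ℝ) :
    Integrable fun t : ℝ => C * (1 + ‖t‖) ^ (-2 : ℝ) :=
  (integrable_one_add_norm (by simp)).const_mul C

theorem norm_exp_neg_I_mul (t y : ℝ) : ‖Complex.exp (-Complex.I * t * y)‖ = 1 := by
  rw [show -Complex.I * t * y = ((-(t * y) : ℝ) : ℂ) * Complex.I by push_cast; ring]
  exact Complex.norm_exp_ofReal_mul_I _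

theorem integrable_wig_integrand (w : 𝓢(ℝ × ℝ, ℂ)) (p : ℝ × ℝ) : Integrable fun t : ℝ =>
    Complex.exp (-Complex.I * t * p.2) * w (p.1 + t / 2, p.1 - t / 2) := by
  obtain ⟨C, hC⟩ := w.exists_antidiagonal_bound
  have := w.continuous
  refine (integrable_const_mul_one_add_norm_rpow C).mono' (by fun_prop)
    (Filter.Eventually.of_forall fun t => ?_)
  rw [norm_mul, norm_exp_neg_I_mul, one_mul]
  refine le_trans ?_ (hC p.1 t)
  exact le_mul_of_one_le_left (norm_nonneg _) (by simp)

theorem Wig_sum_smul {ι : Type*} (S : Finset ι) (c : ι → ℂ) (w : ι → 𝓢(ℝ × ℝ, ℂ)) :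
    Wig (∑ i ∈ S, c i • ⇑(w i)) = ∑ i ∈ S, c i • Wig (w i) := by
  ext p
  simp only [Wig, Finset.sum_apply, Pi.smul_apply, smul_eq_mul, Finset.mul_sum]
  rw [integral_finsetSum]
  · simp only [mul_left_comm _ (c _), integral_const_mul]
  · intro i _
    simp only [mul_left_comm _ (c _)]
    exact (integrable_wig_integrand (w i) p).const_mul (c i)

/-- The derivative in `p` of the integrand defining `Wig w p`. -/
def wigFDeriv (w : 𝓢(ℝ × ℝ, ℂ)) (p : ℝ × ℝ) (t : ℝ) : ℝ × ℝ →L[ℝ] ℂ :=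
  Complex.exp (-Complex.I * t * p.2) •
    ((fderiv ℝ w (p.1 + t / 2, p.1 - t / 2)).comp
        ((ContinuousLinearMap.fst ℝ ℝ ℝ).prod (ContinuousLinearMap.fst ℝ ℝ ℝ)) +
      (-Complex.I * t * w (p.1 + t / 2, p.1 - t / 2)) •
        Complex.ofRealCLM.comp (ContinuousLinearMap.snd ℝ ℝ ℝ))

theorem hasFDerivAt_wig_integrand (w : 𝓢(ℝ × ℝ, ℂ)) (t : ℝ) (p : ℝ × ℝ) :
    HasFDerivAt (fun q : ℝ × ℝ =>
      Complex.exp (-Complex.I * t * q.2) * w (q.1 + t / 2, q.1 - t / 2)) (wigFDeriv w p t) p := by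
  have he : HasFDerivAt (fun q : ℝ × ℝ => Complex.exp (-Complex.I * t * q.2))
      (Complex.exp (-Complex.I * t * p.2) • (-Complex.I * t) •
        Complex.ofRealCLM.comp (ContinuousLinearMap.snd ℝ ℝ ℝ)) p :=
    ((Complex.ofRealCLM.comp (ContinuousLinearMap.snd ℝ ℝ ℝ)).hasFDerivAt.const_mul
      (-Complex.I * t)).cexp
  have hl : HasFDerivAt (fun q : ℝ × ℝ => (q.1 + t / 2, q.1 - t / 2))
      ((ContinuousLinearMap.fst ℝ ℝ ℝ).prod (ContinuousLinearMap.fst ℝ ℝ ℝ)) p :=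
    (hasFDerivAt_fst.add_const _).prodMk (hasFDerivAt_fst.sub_const _)
  have hw := (w.differentiableAt (x := (p.1 + t / 2, p.1 - t / 2))).hasFDerivAt.comp p hl
  refine (he.mul hw).congr_fderiv ?_
  ext
  · simp [wigFDeriv]
  · simp [wigFDeriv]
    ring

theorem exists_norm_wigFDeriv_le (w : 𝓢(ℝ × ℝ, ℂ)) :
    ∃ C : ℝ, ∀ p t, ‖wigFDeriv w p t‖ ≤ C * (1 + ‖t‖) ^ (-2 : ℝ) := by
  obtain ⟨C, hC⟩ := w.exists_antidiagonal_bound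
  obtain ⟨C', hC'⟩ := (fderivCLM ℝ (ℝ × ℝ) ℂ w).exists_antidiagonal_bound
  set A := ‖(ContinuousLinearMap.fst ℝ ℝ ℝ).prod (ContinuousLinearMap.fst ℝ ℝ ℝ)‖
  have hA : 0 ≤ A := norm_nonneg _
  set B := ‖Complex.ofRealCLM.comp (ContinuousLinearMap.snd ℝ ℝ ℝ)‖
  have hB : 0 ≤ B := norm_nonneg _
  refine ⟨C' * A + C * B, fun p t => ?_⟩
  have h := hC p.1 t
  have h' := hC' p.1 t
  rw [fderivCLM_apply] at h'
  rw [wigFDeriv, norm_smul, norm_exp_neg_I_mul, one_mul]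
  refine (norm_add_le _ _).trans ?_
  rw [add_mul, mul_right_comm C', mul_right_comm C]
  refine add_le_add ((ContinuousLinearMap.opNorm_comp_le _ _).trans ?_) ?_
  · refine mul_le_mul_of_nonneg_right (le_trans ?_ h') hA
    exact le_mul_of_one_le_left (norm_nonneg _) (by simp)
  · rw [norm_smul]
    refine mul_le_mul_of_nonneg_right (le_trans ?_ h) hB
    rw [norm_mul, norm_mul, norm_neg, Complex.norm_I, one_mul, Complex.norm_real, Real.norm_eq_abs]
    exact mul_le_mul_of_nonneg_right (by linarith) (norm_nonneg _)

theorem continuous_wigFDeriv (w : 𝓢(ℝ × ℝ, ℂ)) (p : ℝ × ℝ) : Continuous (wigFDeriv w p) := by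
  have h := w.continuous
  have h' : Continuous (fderiv ℝ w) := (fderivCLM ℝ (ℝ × ℝ) ℂ w).continuous
  unfold wigFDeriv
  fun_prop

theorem integrable_wigFDeriv (w : 𝓢(ℝ × ℝ, ℂ)) (p : ℝ × ℝ) : Integrable (wigFDeriv w p) := by
  obtain ⟨C, hC⟩ := exists_norm_wigFDeriv_le w
  exact (integrable_const_mul_one_add_norm_rpow C).mono'
    (continuous_wigFDeriv w p).aestronglyMeasurable (Filter.Eventually.of_forall (hC p))

theorem fderiv_Wig_apply (w : 𝓢(ℝ × ℝ, ℂ)) (p v : ℝ × ℝ) :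
    fderiv ℝ (Wig w) p v = ∫ t, wigFDeriv w p t v := by
  obtain ⟨C, hC⟩ := exists_norm_wigFDeriv_le w
  rw [← ContinuousLinearMap.integral_apply (integrable_wigFDeriv w p)]
  congr 1
  exact (hasFDerivAt_integral_of_dominated_of_fderiv_le Filter.univ_mem
    (Filter.Eventually.of_forall fun q => (integrable_wig_integrand w q).aestronglyMeasurable)
    (integrable_wig_integrand w p) (continuous_wigFDeriv w p).aestronglyMeasurable
    (Filter.Eventually.of_forall fun t q _ => hC q t) (integrable_const_mul_one_add_norm_rpow C)
    (Filter.Eventually.of_forall fun t q _ => hasFDerivAt_wig_integrand w t q)).fderiv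

theorem M1_Wig (w : 𝓢(ℝ × ℝ, ℂ)) :
    M1 (Wig w) = Wig ⇑((((1 : ℂ) / 2) • (mulSnd + mulFst)) w) := by
  ext p
  simp only [M1, Wig]
  rw [← integral_const_mul]
  congr 1 with t
  simp [mulFst_apply, mulSnd_apply]
  ring

theorem D1_Wig (w : 𝓢(ℝ × ℝ, ℂ)) :
    D1 (Wig w) = Wig ⇑((dirD (1, 0) + dirD (0, 1)) w) := by
  ext p
  simp only [D1, fderiv_Wig_apply]
  rw [Wig, ← integral_const_mul]
  congr 1 with t
  have h : fderiv ℝ w (p.1 + t / 2, p.1 - t / 2) (1, 1) =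
      fderiv ℝ w (p.1 + t / 2, p.1 - t / 2) (1, 0) +
        fderiv ℝ w (p.1 + t / 2, p.1 - t / 2) (0, 1) := by
    rw [← map_add]; simp
  simp [wigFDeriv, dirD_apply, h]
  ring

theorem D2_Wig (w : 𝓢(ℝ × ℝ, ℂ)) : D2 (Wig w) = Wig ⇑((mulSnd - mulFst) w) := by
  ext p
  simp only [D2, fderiv_Wig_apply]
  rw [Wig, ← integral_const_mul]
  congr 1 with t
  simp [wigFDeriv, mulFst_apply, mulSnd_apply, Prod.mk_zero_zero]
  linear_combination (t * Complex.exp (-(Complex.I * t * p.2)) *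
    w (p.1 + t / 2, p.1 - t / 2)) * Complex.I_mul_I

theorem M2_Wig (w : 𝓢(ℝ × ℝ, ℂ)) :
    M2 (Wig w) = Wig ⇑((((1 : ℂ) / 2) • (dirD (1, 0) - dirD (0, 1))) w) := by
  ext p
  set e : ℝ → ℂ := fun t => Complex.exp (-Complex.I * t * p.2) with he_def
  set g : ℝ → ℂ := fun t => w (p.1 + t / 2, p.1 - t / 2) with hg_def
  set u : 𝓢(ℝ × ℝ, ℂ) := (((1 : ℂ) / 2) • (dirD (1, 0) - dirD (0, 1))) w with hu
  have he (t : ℝ) : HasDerivAt e (-Complex.I * p.2 * e t) t := by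
    have h := (((hasDerivAt_id t).ofReal_comp.const_mul (-Complex.I)).mul_const (p.2 : ℂ)).cexp
    refine h.congr_deriv ?_
    simp [he_def]
    ring
  have hg (t : ℝ) : HasDerivAt g (Complex.I * u (p.1 + t / 2, p.1 - t / 2)) t := by
    have hl : HasDerivAt (fun t : ℝ => (p.1 + t / 2, p.1 - t / 2)) ((1 / 2 : ℝ), -(1 / 2 : ℝ)) t :=
      (((hasDerivAt_id t).div_const 2).const_add p.1).prodMk
        (((hasDerivAt_id t).div_const 2).const_sub p.1)
    refine ((w.differentiableAt.hasFDerivAt).comp_hasDerivAt t hl).congr_deriv ?_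
    rw [show ((1 / 2 : ℝ), -(1 / 2 : ℝ)) = (1 / 2 : ℝ) • ((1, 0) - (0, 1) : ℝ × ℝ) by
      simp, map_smul, map_sub]
    simp [hu, dirD_apply]
    linear_combination ((fderiv ℝ w (p.1 + t / 2, p.1 - t / 2) (1, 0) -
      fderiv ℝ w (p.1 + t / 2, p.1 - t / 2) (0, 1)) / 2) * Complex.I_mul_I
  have hparts := integral_mul_deriv_eq_deriv_mul_of_integrable (fun t _ => he t) (fun t _ => hg t)
    (((integrable_wig_integrand u p).const_mul Complex.I).congr
      (Filter.Eventually.of_forall fun t => by simp [he_def]; ring))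
    (((integrable_wig_integrand w p).const_mul (-Complex.I * p.2)).congr
      (Filter.Eventually.of_forall fun t => by simp [he_def, hg_def]; ring))
    (integrable_wig_integrand w p)
  simp only [mul_left_comm _ Complex.I, mul_assoc, integral_const_mul, neg_mul, integral_neg,
    neg_neg] at hparts
  simpa [M2, Wig, he_def, hg_def] using (mul_left_cancel₀ Complex.I_ne_zero hparts).symm

/-- If `A ∘ Wig = Wig ∘ B` on Schwartz functions, the same holds for iterates. -/
theorem iterate_Wig {A : Fn2 → Fn2} {B : 𝓢(ℝ × ℝ, ℂ) →L[ℂ] 𝓢(ℝ × ℝ, ℂ)}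
    (h : ∀ w : 𝓢(ℝ × ℝ, ℂ), A (Wig w) = Wig ⇑(B w)) (n : ℕ) (w : 𝓢(ℝ × ℝ, ℂ)) :
    A^[n] (Wig w) = Wig ⇑((B ^ n) w) := by
  have hs : Function.Semiconj (fun v : 𝓢(ℝ × ℝ, ℂ) => Wig v) B A := fun v => (h v).symm
  simpa [FunLike.coe_pow_eq_iterate] using ((hs.iterate_right n) w).symm

theorem iterate_coe {b : Fn2 → Fn2} {B : 𝓢(ℝ × ℝ, ℂ) →L[ℂ] 𝓢(ℝ × ℝ, ℂ)}
    (h : ∀ w : 𝓢(ℝ × ℝ, ℂ), ⇑(B w) = b w) (n : ℕ) (w : 𝓢(ℝ × ℝ, ℂ)) :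
    b^[n] ⇑w = ⇑((B ^ n) w) := by
  have hs : Function.Semiconj (fun v : 𝓢(ℝ × ℝ, ℂ) => (v : Fn2)) B b := h
  simpa [FunLike.coe_pow_eq_iterate] using ((hs.iterate_right n) w).symm

theorem monomial_Wig (w : 𝓢(ℝ × ℝ, ℂ)) (m n h k : ℕ) :
    M1^[m] (M2^[n] (D1^[h] (D2^[k] (Wig w)))) =
      Wig ⇑(((((1 : ℂ) / 2) • (mulSnd + mulFst)) ^ m)
        (((((1 : ℂ) / 2) • (dirD (1, 0) - dirD (0, 1))) ^ n)
          (((dirD (1, 0) + dirD (0, 1)) ^ h) (((mulSnd - mulFst) ^ k) w)))) := by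
  rw [iterate_Wig D2_Wig, iterate_Wig D1_Wig, iterate_Wig M2_Wig, iterate_Wig M1_Wig]

theorem statement1 (w : 𝓢(ℝ × ℝ, ℂ)) :
    (∀ m n h k : ℕ,
      M1^[m] (M2^[n] (D1^[h] (D2^[k] (Wig ⇑w)))) =
        Wig ((((2 : ℂ) ^ (n + m))⁻¹) •
          (M2 + M1)^[m] ((D1 - D2)^[n] ((M2 - M1)^[k] ((D1 + D2)^[h] ⇑w))))) ∧
    (∀ (S : Finset (ℕ × ℕ × ℕ × ℕ)) (c : ℕ × ℕ × ℕ × ℕ → ℂ),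
      ∑ q ∈ S, c q • M1^[q.1] (M2^[q.2.1] (D1^[q.2.2.1] (D2^[q.2.2.2] (Wig ⇑w)))) =
        Wig (∑ q ∈ S, c q •
          (((1 : ℂ) / 2) • (M2 + M1))^[q.1]
            ((((1 : ℂ) / 2) • (D1 - D2))^[q.2.1]
              ((D1 + D2)^[q.2.2.1] ((M2 - M1)^[q.2.2.2] ⇑w))))) := by
  refine ⟨fun m n h k => ?_, fun S c => ?_⟩
  · rw [monomial_Wig, iterate_coe coe_dirD_add_dirD, iterate_coe coe_mulSnd_sub_mulFst,
      iterate_coe coe_dirD_sub_dirD, iterate_coe coe_mulSnd_add_mulFst, ← FunLike.coe_smul]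
    have hc := DFunLike.congr_fun (commute_dirD_add_mulSnd_sub.pow_pow h k).eq w
    simp only [mul_apply_eq_comp] at hc
    rw [hc, smul_pow, smul_pow]
    simp only [smul_apply, map_smul, smul_smul]
    congr 3
    rw [pow_add, mul_inv, one_div, inv_pow, inv_pow, mul_comm]
  · have hM (v : 𝓢(ℝ × ℝ, ℂ)) :
        ⇑((((1 : ℂ) / 2) • (mulSnd + mulFst)) v) = (((1 : ℂ) / 2) • (M2 + M1)) v := by
      rw [Pi.smul_apply, ← coe_mulSnd_add_mulFst]; rfl
    have hD (v : 𝓢(ℝ × ℝ, ℂ)) :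
        ⇑((((1 : ℂ) / 2) • (dirD (1, 0) - dirD (0, 1))) v) = (((1 : ℂ) / 2) • (D1 - D2)) v := by
      rw [Pi.smul_apply, ← coe_dirD_sub_dirD]; rfl
    simp only [monomial_Wig, iterate_coe coe_mulSnd_sub_mulFst, iterate_coe coe_dirD_add_dirD,
      iterate_coe hD, iterate_coe hM]
    exact (Wig_sum_smul S c _).symm
end
end

section
/- Let P(ξ,η) be a real polynomial, σ := 𝓕⁻¹(e^{−iP(ξ,η)}) ∈ 𝒮′(ℝ²), and let q(ξ,η) be a complex polynomial; set σ₁ := q(D₁,D₂)σ, i.e. 𝓕σ₁ = q·e^{−iP}. Then for every Schwartz function w on ℝ², Q^{(σ₁)}[w] := σ₁ * Wig[w] satisfies Q^{(σ₁)}[w] = Q^{(σ)}[ q(D₁+D₂, M₂−M₁) w ], where Q^{(σ)}[v] := σ * Wig[v]. -/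
/-!
STATEMENT 7. Let `P(ξ,η)` be a real polynomial, `σ = 𝓕⁻¹(e^{-iP})`, `q(ξ,η)` a complex
polynomial, and `σ₁ = q(D₁,D₂)σ`, i.e. `𝓕σ₁ = q·e^{-iP}`.  Then for every Schwartz `w` on ℝ²,
`Q^{(σ₁)}[w] := σ₁ * Wig[w] = 𝓕⁻¹(q e^{-iP} ⬝ 𝓕(Wig[w]))` satisfies
`Q^{(σ₁)}[w] = Q^{(σ)}[q(D₁+D₂, M₂-M₁) w]`, where `Q^{(σ)}[v] := σ * Wig[v]`.
-/

noncomputable section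
open MeasureTheory Complex SchwartzMap

def FT2 (f : Fn2) : Fn2 :=
  fun ξ => ∫ p : ℝ × ℝ, Complex.exp (-Complex.I * ((p.1 * ξ.1 + p.2 * ξ.2 : ℝ) : ℂ)) * f p

def FT2inv (g : Fn2) : Fn2 :=
  fun x => ((2 * Real.pi : ℝ) : ℂ)⁻¹ ^ 2 *
    ∫ ξ : ℝ × ℝ, Complex.exp (Complex.I * ((x.1 * ξ.1 + x.2 * ξ.2 : ℝ) : ℂ)) * g ξ

def Pval (P : MvPolynomial (Fin 2) ℝ) (ξ : ℝ × ℝ) : ℝ := MvPolynomial.eval ![ξ.1, ξ.2] P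

/-- Evaluation of a complex polynomial in two variables. -/
def qval (q : MvPolynomial (Fin 2) ℂ) (ξ : ℝ × ℝ) : ℂ :=
  MvPolynomial.eval ![(ξ.1 : ℂ), (ξ.2 : ℂ)] q

/-- `Q^{(σ)}[w] = σ * Wig[w]` with kernel `σ = 𝓕⁻¹(e^{-iP})`. -/
def Qrep (P : MvPolynomial (Fin 2) ℝ) (w : Fn2) : Fn2 :=
  FT2inv (fun ξ => Complex.exp (-Complex.I * ((Pval P ξ : ℝ) : ℂ)) * FT2 (Wig w) ξ)

/-- `Q^{(σ₁)}[w] = σ₁ * Wig[w]` with kernel `σ₁ = q(D₁,D₂)σ`, i.e. `𝓕σ₁ = q·e^{-iP}`. -/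
def Qrep1 (q : MvPolynomial (Fin 2) ℂ) (P : MvPolynomial (Fin 2) ℝ) (w : Fn2) : Fn2 :=
  FT2inv (fun ξ => qval q ξ * Complex.exp (-Complex.I * ((Pval P ξ : ℝ) : ℂ)) * FT2 (Wig w) ξ)

/-- Substitution of two (commuting) operators in a complex polynomial `q(ξ,η)`. -/
def polyOpC (q : MvPolynomial (Fin 2) ℂ) (A B : Fn2 → Fn2) : Fn2 → Fn2 :=
  fun f => ∑ d ∈ q.support, MvPolynomial.coeff d q • A^[d 0] (B^[d 1] f)

lemma hasTemperateGrowth_prodMk_left (x : ℝ) :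
    Function.HasTemperateGrowth fun t : ℝ => (x, t) := by
  convert! (Function.HasTemperateGrowth.const ((x, 0) : ℝ × ℝ)).add
    (ContinuousLinearMap.inr ℝ ℝ ℝ).hasTemperateGrowth using 1
  ext t <;> simp

lemma hasTemperateGrowth_prodMk_right (t : ℝ) :
    Function.HasTemperateGrowth fun x : ℝ => (x, t) := by
  convert! (Function.HasTemperateGrowth.const ((0, t) : ℝ × ℝ)).add
    (ContinuousLinearMap.inl ℝ ℝ ℝ).hasTemperateGrowth using 1
  ext x <;> simp

/-- The restriction of a Schwartz function on the plane to a vertical line. -/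
def SchwartzMap.verticalSection (F : 𝓢(ℝ × ℝ, ℂ)) (x : ℝ) : 𝓢(ℝ, ℂ) :=
  SchwartzMap.compCLMOfAntilipschitz ℂ (K := 1) (g := fun t : ℝ => (x, t)) (hasTemperateGrowth_prodMk_left x)
    (AntilipschitzWith.of_le_mul_dist fun a b => by simp [Prod.dist_eq]) F

/-- The restriction of a Schwartz function on the plane to a horizontal line. -/
def SchwartzMap.horizontalSection (F : 𝓢(ℝ × ℝ, ℂ)) (t : ℝ) : 𝓢(ℝ, ℂ) :=
  SchwartzMap.compCLMOfAntilipschitz ℂ (K := 1) (g := fun x : ℝ => (x, t)) (hasTemperateGrowth_prodMk_right t)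
    (AntilipschitzWith.of_le_mul_dist fun a b => by simp [Prod.dist_eq]) F

lemma SchwartzMap.verticalSection_apply (F : 𝓢(ℝ × ℝ, ℂ)) (x t : ℝ) :
    F.verticalSection x t = F (x, t) := rfl

lemma SchwartzMap.horizontalSection_apply (F : 𝓢(ℝ × ℝ, ℂ)) (t x : ℝ) :
    F.horizontalSection t x = F (x, t) := rfl

lemma SchwartzMap.deriv_verticalSection (F : 𝓢(ℝ × ℝ, ℂ)) (x : ℝ) :
    deriv (F.verticalSection x) = (LineDeriv.lineDerivOp ((0, 1) : ℝ × ℝ) F).verticalSection x := by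
  ext t
  exact ((F.hasFDerivAt (x, t)).comp_hasDerivAt t
    ((hasDerivAt_const t x).prodMk (hasDerivAt_id t))).deriv

lemma SchwartzMap.deriv_horizontalSection (F : 𝓢(ℝ × ℝ, ℂ)) (t : ℝ) :
    deriv (F.horizontalSection t) =
      (LineDeriv.lineDerivOp ((1, 0) : ℝ × ℝ) F).horizontalSection t := by
  ext x
  exact ((F.hasFDerivAt (x, t)).comp_hasDerivAt x
    ((hasDerivAt_id x).prodMk (hasDerivAt_const x t))).deriv

open scoped FourierTransform in
lemma integral_exp_mul_eq_fourier (f : ℝ → ℂ) (y : ℝ) :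
    ∫ t : ℝ, Complex.exp (-Complex.I * t * y) * f t = 𝓕 f (y / (2 * Real.pi)) := by
  rw [Real.fourier_real_eq_integral_exp_smul]
  congr 1 with t
  rw [smul_eq_mul]
  congr 2
  have : (Real.pi : ℂ) ≠ 0 := by exact_mod_cast Real.pi_ne_zero
  push_cast
  field_simp

open scoped FourierTransform in
lemma integral_exp_mul_deriv (f : 𝓢(ℝ, ℂ)) (y : ℝ) :
    ∫ t : ℝ, Complex.exp (-Complex.I * t * y) * deriv f t =
      Complex.I * y * ∫ t : ℝ, Complex.exp (-Complex.I * t * y) * f t := by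
  rw [integral_exp_mul_eq_fourier, integral_exp_mul_eq_fourier,
    Real.fourier_deriv f.integrable f.differentiable (SchwartzMap.derivCLM ℂ ℂ f).integrable]
  have : (Real.pi : ℂ) ≠ 0 := by exact_mod_cast Real.pi_ne_zero
  simp only [smul_eq_mul]
  push_cast
  field_simp

open scoped FourierTransform in
lemma integral_exp_mul_integral_exp_mul (f : 𝓢(ℝ, ℂ)) (s : ℝ) :
    ∫ y : ℝ, Complex.exp (-Complex.I * y * s) *
      ∫ t : ℝ, Complex.exp (-Complex.I * t * y) * f t = 2 * Real.pi * f (-s) := by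
  simp_rw [integral_exp_mul_eq_fourier f]
  have hpi : (Real.pi : ℂ) ≠ 0 := by exact_mod_cast Real.pi_ne_zero
  have h : ∀ y : ℝ, Complex.exp (-Complex.I * y * s) * 𝓕 (f : ℝ → ℂ) (y / (2 * Real.pi)) =
      (fun v : ℝ => Complex.exp (2 * Real.pi * v * (-s) * Complex.I) * 𝓕 (f : ℝ → ℂ) v)
        (y / (2 * Real.pi)) := by
    intro y
    simp only
    congr 2
    push_cast
    field_simp
  simp_rw [h]
  rw [Measure.integral_comp_div
    (fun v : ℝ => Complex.exp (2 * Real.pi * v * (-s) * Complex.I) * 𝓕 (f : ℝ → ℂ) v)]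
  have hinv : 𝓕⁻ (𝓕 (f : ℝ → ℂ)) = f :=
    f.continuous.fourierInv_fourier_eq f.integrable (by
      rw [← SchwartzMap.fourier_coe]; exact (𝓕 f).integrable)
  have := congrFun hinv (-s)
  rw [Real.fourierInv_eq'] at this
  rw [← this, abs_of_pos Real.two_pi_pos]
  simp only [smul_eq_mul, Complex.real_smul]
  push_cast
  congr 2 with v
  congr 2
  simp
  ring

/-- The map `(x, t) ↦ (x + t / 2, x - t / 2)`. -/
def wignerCoord : (ℝ × ℝ) ≃L[ℝ] ℝ × ℝ :=
  LinearEquiv.toContinuousLinearEquiv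
    { toFun := fun p => (p.1 + p.2 / 2, p.1 - p.2 / 2)
      invFun := fun p => ((p.1 + p.2) / 2, p.1 - p.2)
      map_add' := fun p q => by ext <;> simp <;> ring
      map_smul' := fun c p => by ext <;> simp <;> ring
      left_inv := fun p => by ext <;> simp
      right_inv := fun p => by ext <;> simp <;> ring }

lemma wignerCoord_apply (p : ℝ × ℝ) : wignerCoord p = (p.1 + p.2 / 2, p.1 - p.2 / 2) := rfl

lemma norm_exp_neg_I_mul_mul (a b : ℝ) : ‖Complex.exp (-Complex.I * a * b)‖ = 1 := by
  rw [show -Complex.I * a * b = ((-(a * b) : ℝ) : ℂ) * Complex.I by push_cast; ring]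
  exact Complex.norm_exp_ofReal_mul_I _

lemma integrable_exp_mul (f : 𝓢(ℝ, ℂ)) (y : ℝ) :
    Integrable fun t : ℝ => Complex.exp (-Complex.I * t * y) * f t :=
  f.integrable.bdd_mul (c := 1) (by fun_prop) (.of_forall fun t => (norm_exp_neg_I_mul_mul t y).le)

lemma integrable_partialFourier (G : 𝓢(ℝ × ℝ, ℂ)) :
    Integrable fun p : ℝ × ℝ => ∫ t : ℝ, Complex.exp (-Complex.I * t * p.2) * G (p.1, t) := by
  let V : 𝓢(ℝ × ℝ, ℂ) := LineDeriv.lineDerivOp ((0, 1) : ℝ × ℝ) G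
  let W : 𝓢(ℝ × ℝ, ℂ) := LineDeriv.lineDerivOp ((0, 1) : ℝ × ℝ) V
  have hbound : Integrable fun p : ℝ × ℝ => (∫ t : ℝ, ‖(G - W) (p.1, t)‖) * (1 + p.2 ^ 2)⁻¹ :=
    Integrable.mul_prod (f := fun x : ℝ => ∫ t : ℝ, ‖(G - W) (x, t)‖)
      (G - W).integrable.integral_norm_prod_left integrable_inv_one_add_sq
  refine hbound.mono' ?_ (.of_forall fun p => ?_)
  · refine (StronglyMeasurable.integral_prod_right (ν := volume)
      (f := fun (p : ℝ × ℝ) (t : ℝ) => Complex.exp (-Complex.I * t * p.2) * G (p.1, t))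
      ?_).aestronglyMeasurable
    have := G.continuous
    exact Continuous.stronglyMeasurable (by fun_prop)
  · obtain ⟨x, y⟩ := p
    have hW : ∫ t : ℝ, Complex.exp (-Complex.I * t * y) * W (x, t) =
        -(y : ℂ) ^ 2 * ∫ t : ℝ, Complex.exp (-Complex.I * t * y) * G (x, t) := by
      have h1 := integral_exp_mul_deriv (G.verticalSection x) y
      have h2 := integral_exp_mul_deriv (V.verticalSection x) y
      rw [SchwartzMap.deriv_verticalSection] at h1 h2
      simp only [SchwartzMap.verticalSection_apply] at h1 h2
      rw [h2, h1]
      linear_combination ((y : ℂ) ^ 2 *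
        ∫ t : ℝ, Complex.exp (-Complex.I * t * y) * G (x, t)) * Complex.I_sq
    have key : ∫ t : ℝ, Complex.exp (-Complex.I * t * y) * (G - W) (x, t) =
        ((1 + y ^ 2 : ℝ) : ℂ) * ∫ t : ℝ, Complex.exp (-Complex.I * t * y) * G (x, t) := by
      have h := integral_sub (integrable_exp_mul (G.verticalSection x) y)
        (integrable_exp_mul (W.verticalSection x) y)
      simp only [SchwartzMap.verticalSection_apply] at h
      simp only [sub_apply, mul_sub]
      rw [h, hW]
      push_cast
      ring
    have hpos : 0 < 1 + y ^ 2 := by positivity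
    rw [← div_eq_mul_inv, le_div_iff₀ hpos, mul_comm]
    calc (1 + y ^ 2) * ‖∫ t : ℝ, Complex.exp (-Complex.I * t * y) * G (x, t)‖
        = ‖∫ t : ℝ, Complex.exp (-Complex.I * t * y) * (G - W) (x, t)‖ := by
          rw [key, norm_mul, Complex.norm_real, Real.norm_of_nonneg hpos.le]
      _ ≤ ∫ t : ℝ, ‖Complex.exp (-Complex.I * t * y) * (G - W) (x, t)‖ :=
          norm_integral_le_integral_norm _
      _ = ∫ t : ℝ, ‖(G - W) (x, t)‖ := by
          simp only [norm_mul, norm_exp_neg_I_mul_mul, one_mul]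

/-- A Schwartz function in the coordinates of the Wigner integrand, restricted to a line. -/
def ambiguitySection (s : ℝ) : 𝓢(ℝ × ℝ, ℂ) → 𝓢(ℝ, ℂ) := fun w =>
  (SchwartzMap.compCLMOfContinuousLinearEquiv ℂ wignerCoord w).horizontalSection (-s)

lemma ambiguitySection_apply (s : ℝ) (w : 𝓢(ℝ × ℝ, ℂ)) (x : ℝ) :
    ambiguitySection s w x = w (x + -s / 2, x - -s / 2) := rfl

/-- The Fourier transform of the Wigner transform is an ambiguity function. -/
lemma FT2_Wig (w : 𝓢(ℝ × ℝ, ℂ)) (ξ : ℝ × ℝ) :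
    FT2 (Wig w) ξ = 2 * Real.pi *
      ∫ x : ℝ, Complex.exp (-Complex.I * x * ξ.1) * ambiguitySection ξ.2 w x := by
  let G := SchwartzMap.compCLMOfContinuousLinearEquiv ℂ wignerCoord w
  have hW : Integrable (Wig w) := integrable_partialFourier G
  have hint : Integrable fun p : ℝ × ℝ =>
      Complex.exp (-Complex.I * ((p.1 * ξ.1 + p.2 * ξ.2 : ℝ) : ℂ)) * Wig w p :=
    hW.bdd_mul (c := 1) (by fun_prop) (.of_forall fun p => by
      simpa using (norm_exp_neg_I_mul_mul 1 (p.1 * ξ.1 + p.2 * ξ.2)).le)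
  rw [FT2, Measure.volume_eq_prod, integral_prod _ hint, ← integral_const_mul]
  congr 1 with x
  have h := integral_exp_mul_integral_exp_mul (G.verticalSection x) ξ.2
  have hval : G.verticalSection x (-ξ.2) = ambiguitySection ξ.2 w x := rfl
  rw [hval] at h
  rw [mul_left_comm, ← h, ← integral_const_mul]
  congr 1 with y
  rw [← mul_assoc, ← Complex.exp_add]
  congr 2
  push_cast
  ring

lemma FT2_Wig_sum {ι : Type*} (s : Finset ι) (c : ι → ℂ) (f : ι → 𝓢(ℝ × ℝ, ℂ)) (ξ : ℝ × ℝ) :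
    FT2 (Wig (∑ i ∈ s, c i • ⇑(f i))) ξ = ∑ i ∈ s, c i * FT2 (Wig (f i)) ξ := by
  have hcoe : ∑ i ∈ s, c i • ⇑(f i) = ⇑(∑ i ∈ s, c i • f i) := by
    ext p
    simp
  have hint : ∀ i ∈ s, Integrable fun x : ℝ =>
      c i * (Complex.exp (-Complex.I * x * ξ.1) * ambiguitySection ξ.2 (f i) x) :=
    fun i _ => (integrable_exp_mul _ _).const_mul _
  have hsum : ∀ x : ℝ, Complex.exp (-Complex.I * x * ξ.1) *
      ambiguitySection ξ.2 (∑ i ∈ s, c i • f i) x =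
      ∑ i ∈ s, c i * (Complex.exp (-Complex.I * x * ξ.1) * ambiguitySection ξ.2 (f i) x) := by
    intro x
    simp only [ambiguitySection_apply, sum_apply, smul_apply, smul_eq_mul,
      Finset.mul_sum, mul_left_comm]
  simp only [hcoe, FT2_Wig, hsum, integral_finsetSum s hint, integral_const_mul, Finset.mul_sum,
    mul_left_comm]

lemma exists_schwartz_D1_add_D2 (w : 𝓢(ℝ × ℝ, ℂ)) :
    ∃ v : 𝓢(ℝ × ℝ, ℂ), (D1 + D2) w = v ∧
      ∀ ξ, FT2 (Wig v) ξ = ξ.1 * FT2 (Wig w) ξ := by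
  let v₀ : 𝓢(ℝ × ℝ, ℂ) := LineDeriv.lineDerivOp ((1, 1) : ℝ × ℝ) w
  have hv₀ : ∀ p, v₀ p = fderiv ℝ w p (1, 1) := fun p => rfl
  refine ⟨-Complex.I • v₀, ?_, fun ξ => ?_⟩
  · ext p
    have : ((1, 1) : ℝ × ℝ) = (1, 0) + (0, 1) := by simp
    simp only [Pi.add_apply, D1, D2, smul_apply, hv₀, smul_eq_mul, this, map_add]
    ring
  · have hderiv : deriv (ambiguitySection ξ.2 w) = ambiguitySection ξ.2 v₀ := by
      ext x
      exact ((w.hasFDerivAt (x + -ξ.2 / 2, x - -ξ.2 / 2)).comp_hasDerivAt x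
        (((hasDerivAt_id x).add_const (-ξ.2 / 2)).prodMk
          ((hasDerivAt_id x).sub_const (-ξ.2 / 2)))).deriv
    have h := integral_exp_mul_deriv (ambiguitySection ξ.2 w) ξ.1
    rw [hderiv] at h
    have hsmul : ∀ x, ambiguitySection ξ.2 (-Complex.I • v₀) x =
        -Complex.I * ambiguitySection ξ.2 v₀ x := fun x => rfl
    simp only [FT2_Wig, hsmul, mul_left_comm _ (-Complex.I), integral_const_mul, h]
    linear_combination (-(ξ.1 : ℂ) * (2 * Real.pi *
      ∫ x : ℝ, Complex.exp (-Complex.I * x * ξ.1) * ambiguitySection ξ.2 w x)) * Complex.I_sq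

lemma exists_schwartz_M2_sub_M1 (w : 𝓢(ℝ × ℝ, ℂ)) :
    ∃ v : 𝓢(ℝ × ℝ, ℂ), (M2 - M1) w = v ∧
      ∀ ξ, FT2 (Wig v) ξ = ξ.2 * FT2 (Wig w) ξ := by
  have hg : Function.HasTemperateGrowth fun p : ℝ × ℝ => p.2 - p.1 :=
    (ContinuousLinearMap.snd ℝ ℝ ℝ - ContinuousLinearMap.fst ℝ ℝ ℝ).hasTemperateGrowth
  have hv : ∀ p, SchwartzMap.smulLeftCLM ℂ (fun p : ℝ × ℝ => p.2 - p.1) w p =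
      ((p.2 : ℂ) - p.1) * w p := fun p => by
    rw [SchwartzMap.smulLeftCLM_apply_apply hg, Complex.real_smul, Complex.ofReal_sub]
  refine ⟨SchwartzMap.smulLeftCLM ℂ (fun p : ℝ × ℝ => p.2 - p.1) w, ?_, fun ξ => ?_⟩
  · ext p
    simp only [Pi.sub_apply, M1, M2, hv]
    ring
  · rw [FT2_Wig, FT2_Wig, mul_left_comm, ← integral_const_mul (ξ.2 : ℂ)]
    congr 2 with x
    rw [ambiguitySection_apply, ambiguitySection_apply, hv]
    push_cast
    ring

/-- An operator that preserves Schwartz functions and acts on `FT2 ∘ Wig` as multiplication by `m`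
has iterates acting as multiplication by the powers of `m`. -/
lemma exists_schwartz_iterate {A : Fn2 → Fn2} {m : ℝ × ℝ → ℂ}
    (hA : ∀ w : 𝓢(ℝ × ℝ, ℂ), ∃ v : 𝓢(ℝ × ℝ, ℂ), A w = v ∧
      ∀ ξ, FT2 (Wig v) ξ = m ξ * FT2 (Wig w) ξ) (n : ℕ) (w : 𝓢(ℝ × ℝ, ℂ)) :
    ∃ v : 𝓢(ℝ × ℝ, ℂ), A^[n] w = v ∧ ∀ ξ, FT2 (Wig v) ξ = m ξ ^ n * FT2 (Wig w) ξ := by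
  induction n with
  | zero => exact ⟨w, rfl, fun ξ => by simp⟩
  | succ n ih =>
    obtain ⟨u, hu, hu'⟩ := ih
    obtain ⟨v, hv, hv'⟩ := hA u
    exact ⟨v, by rw [Function.iterate_succ_apply', hu, hv], fun ξ => by rw [hv', hu']; ring⟩

lemma FT2_Wig_polyOpC (q : MvPolynomial (Fin 2) ℂ) (w : 𝓢(ℝ × ℝ, ℂ)) (ξ : ℝ × ℝ) :
    FT2 (Wig (polyOpC q (D1 + D2) (M2 - M1) w)) ξ = qval q ξ * FT2 (Wig w) ξ := by
  have hterm : ∀ d : Fin 2 →₀ ℕ, ∃ v : 𝓢(ℝ × ℝ, ℂ),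
      (D1 + D2)^[d 0] ((M2 - M1)^[d 1] w) = v ∧
        ∀ ξ, FT2 (Wig v) ξ = (ξ.1 : ℂ) ^ d 0 * (ξ.2 : ℂ) ^ d 1 * FT2 (Wig w) ξ := by
    intro d
    obtain ⟨u, hu, hu'⟩ := exists_schwartz_iterate exists_schwartz_M2_sub_M1 (d 1) w
    obtain ⟨v, hv, hv'⟩ := exists_schwartz_iterate exists_schwartz_D1_add_D2 (d 0) u
    exact ⟨v, by rw [hu, hv], fun ξ => by rw [hv', hu', mul_assoc]⟩
  choose v hv hv' using hterm
  simp only [polyOpC, hv]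
  rw [FT2_Wig_sum, qval, MvPolynomial.eval_eq', Finset.sum_mul]
  refine Finset.sum_congr rfl fun d _ => ?_
  rw [hv', Fin.prod_univ_two]
  simp only [Matrix.cons_val_zero, Matrix.cons_val_one]
  ring

theorem statement7 (P : MvPolynomial (Fin 2) ℝ) (q : MvPolynomial (Fin 2) ℂ)
    (w : 𝓢(ℝ × ℝ, ℂ)) :
    Qrep1 q P ⇑w = Qrep P (polyOpC q (D1 + D2) (M2 - M1) ⇑w) := by
  rw [Qrep1, Qrep]
  congr 1 with ξ
  rw [FT2_Wig_polyOpC]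
  ring
end
end

section
/- Let ω be a non-quasianalytic weight function with φ(t) = ω(e^t) and Young conjugate φ*, and let u be a Schwartz function on ℝⁿ. Then the following are equivalent: (1) for every λ > 0 and every multi-index α, sup_{x∈ℝⁿ} e^{λω(|x|)} |D^α u(x)| < ∞ and sup_{ξ∈ℝⁿ} e^{λω(|ξ|)} |D^α û(ξ)| < ∞; (4) both (a) for every multi-index β and every λ > 0 there is C_{β,λ} > 0 such that sup_{x∈ℝⁿ} |x^β D^α u(x)| ≤ C_{β,λ} e^{λφ*(|α|/λ)} for all multi-indices α, and (b) for every multi-index α and every μ > 0 there is C_{α,μ} > 0 such that sup_{x∈ℝⁿ} |x^β D^α u(x)| ≤ C_{α,μ} e^{μφ*(|β|/μ)} for all multi-indices β. -/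
/-!
STATEMENT 11. Let `ω` be a non-quasianalytic weight function, `φ(t) = ω(e^t)` with Young
conjugate `φ*`, and `u ∈ 𝓢(ℝⁿ, ℂ)`.  Then condition (1):
  for all `λ > 0` and multi-indices `α`,
  `sup_x e^{λω(|x|)} |D^α u(x)| < ∞` and `sup_ξ e^{λω(|ξ|)} |D^α û(ξ)| < ∞`
is equivalent to condition (4):
  (a) `∀ β, λ > 0, ∃ C_{β,λ} > 0 : sup_x |x^β D^α u(x)| ≤ C_{β,λ} e^{λφ*(|α|/λ)}` for all `α`,
  (b) `∀ α, μ > 0, ∃ C_{α,μ} > 0 : sup_x |x^β D^α u(x)| ≤ C_{α,μ} e^{μφ*(|β|/μ)}` for all `β`.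
Here `D^α = (-i)^{|α|} ∂^α`, `û(ξ) = ∫ e^{-i⟨x,ξ⟩} u(x) dx`, and
`e^{λφ*(m/λ)} = sup_{s≥0} e^{ms - λω(e^s)}` is formalized as the `ℝ≥0∞`-valued
`expPhiStar ω λ m` (so that the value `+∞` of `φ*` is handled correctly).
-/

noncomputable section
open MeasureTheory Real SchwartzMap
open scoped ENNReal

/-- A non-quasianalytic weight function. -/
structure IsWeightFn (ω : ℝ → ℝ) : Prop where
  cont : ContinuousOn ω (Set.Ici 0)
  mono : MonotoneOn ω (Set.Ici 0)
  nonneg : ∀ t, 0 ≤ t → 0 ≤ ω t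
  alpha : ∃ L > 0, ∀ t, 0 ≤ t → ω (2 * t) ≤ L * (ω t + 1)
  beta : MeasureTheory.IntegrableOn (fun t => ω t / t ^ 2) (Set.Ici 1)
  gamma : ∃ a : ℝ, ∃ b > 0, ∀ t, 0 ≤ t → a + b * Real.log (1 + t) ≤ ω t
  delta : ConvexOn ℝ (Set.Ici 0) fun t => ω (Real.exp t)

/-- `e^{λ φ*(m/λ)} = sup_{s ≥ 0} e^{m s - λ ω(e^s)} ∈ ℝ≥0∞`. -/
def expPhiStar (ω : ℝ → ℝ) (lam m : ℝ) : ℝ≥0∞ :=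
  ⨆ s : Set.Ici (0 : ℝ), ENNReal.ofReal (Real.exp (m * s - lam * ω (Real.exp s)))

variable {n : ℕ}

abbrev En (n : ℕ) := EuclideanSpace ℝ (Fin n)

def pderivE (i : Fin n) (f : En n → ℂ) : En n → ℂ :=
  fun x => fderiv ℝ f x (EuclideanSpace.single i 1)

/-- The iterated partial derivative `∂^α`. -/
def mpderiv (α : Fin n → ℕ) (f : En n → ℂ) : En n → ℂ :=
  (List.finRange n).foldr (fun i g => (pderivE i)^[α i] g) f

/-- `D^α = (-i)^{|α|} ∂^α`. -/
def Dmulti (α : Fin n → ℕ) (f : En n → ℂ) : En n → ℂ :=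
  fun x => (-Complex.I) ^ (∑ i, α i) * mpderiv α f x

/-- Fourier transform, convention `û(ξ) = ∫ e^{-i⟨x,ξ⟩} u(x) dx`. -/
def FTn (f : En n → ℂ) : En n → ℂ :=
  fun ξ => ∫ x : En n, Complex.exp (-Complex.I * ((∑ i, x i * ξ i : ℝ) : ℂ)) * f x

/-- The monomial `x^β`. -/
def xpow (β : Fin n → ℕ) (x : En n) : ℝ := ∏ i, x i ^ β i

/-- Condition (1): `u` and `û` are `O(e^{-λω})` together with all derivatives. -/
def Cond1 (ω : ℝ → ℝ) (u : 𝓢(En n, ℂ)) : Prop :=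
  (∀ lam > (0 : ℝ), ∀ α : Fin n → ℕ, ∃ C : ℝ,
    ∀ x, Real.exp (lam * ω ‖x‖) * ‖Dmulti α ⇑u x‖ ≤ C) ∧
  (∀ lam > (0 : ℝ), ∀ α : Fin n → ℕ, ∃ C : ℝ,
    ∀ ξ, Real.exp (lam * ω ‖ξ‖) * ‖Dmulti α (FTn ⇑u) ξ‖ ≤ C)

lemma IsWeightFn.exists_scale {ω : ℝ → ℝ} (hω : IsWeightFn ω) (B : ℝ) :
    ∃ L > 0, ∀ t, 0 ≤ t → ∀ r ≤ B * t, 0 ≤ r → ω r ≤ L * (ω t + 1) := by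
  obtain ⟨L, hL, hα⟩ := hω.alpha
  have key : ∀ k : ℕ, ∃ M > 0, ∀ t, 0 ≤ t → ω (2 ^ k * t) ≤ M * (ω t + 1) := by
    intro k
    induction k with
    | zero =>
      refine ⟨1, one_pos, fun t _ => ?_⟩
      simp
    | succ k ih =>
      obtain ⟨M, hM, h⟩ := ih
      refine ⟨L * (M + 1), by positivity, fun t ht => ?_⟩
      have h0 := hω.nonneg t ht
      calc ω (2 ^ (k + 1) * t) = ω (2 * (2 ^ k * t)) := by ring_nf
        _ ≤ L * (ω (2 ^ k * t) + 1) := hα _ (by positivity)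
        _ ≤ L * (M * (ω t + 1) + 1 * (ω t + 1)) := by
            gcongr
            · exact h t ht
            · linarith
        _ = L * (M + 1) * (ω t + 1) := by ring
  obtain ⟨k, hk⟩ := pow_unbounded_of_one_lt B (one_lt_two : (1 : ℝ) < 2)
  obtain ⟨M, hM, h⟩ := key k
  refine ⟨M, hM, fun t ht r hr hr0 => ?_⟩
  have hle : r ≤ 2 ^ k * t := hr.trans (by gcongr)
  exact (hω.mono hr0 (hr0.trans hle) hle).trans (h t ht)

lemma IsWeightFn.exists_log_le {ω : ℝ → ℝ} (hω : IsWeightFn ω) (K : ℝ) (hK : 0 ≤ K) :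
    ∃ c ≥ 0, ∃ d, ∀ s, K * s ≤ c * ω (Real.exp s) + d := by
  obtain ⟨a, b, hb, h⟩ := hω.gamma
  refine ⟨K / b, by positivity, -(K / b * a), fun s => ?_⟩
  have h1 := h (Real.exp s) (Real.exp_pos s).le
  have h2 : s ≤ Real.log (1 + Real.exp s) := by
    rw [Real.le_log_iff_exp_le (by positivity)]
    linarith
  have h3 : b * s ≤ ω (Real.exp s) - a := by nlinarith
  calc K * s = K / b * (b * s) := by field_simp
    _ ≤ K / b * (ω (Real.exp s) - a) := by gcongr
    _ = _ := by ring

lemma ofReal_exp_le_expPhiStar (ω : ℝ → ℝ) (lam m : ℝ) {s : ℝ} (hs : 0 ≤ s) :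
    ENNReal.ofReal (Real.exp (m * s - lam * ω (Real.exp s))) ≤ expPhiStar ω lam m :=
  le_iSup (fun s : Set.Ici (0 : ℝ) =>
    ENNReal.ofReal (Real.exp (m * s - lam * ω (Real.exp s)))) ⟨s, hs⟩

lemma IsWeightFn.exists_expPhiStar_le {ω : ℝ → ℝ} (hω : IsWeightFn ω) {B : ℝ} (hB : 1 ≤ B)
    (K : ℕ) {lam : ℝ} (hlam : 0 < lam) :
    ∃ mu > 0, ∃ C > 0, ∀ m m' : ℕ, m' ≤ m + K →
      ENNReal.ofReal (B ^ (m + 1)) * expPhiStar ω mu m' ≤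
        ENNReal.ofReal C * expPhiStar ω lam m := by
  obtain ⟨L, hL, hscale⟩ := hω.exists_scale B
  obtain ⟨c, hc, d, hlog⟩ := hω.exists_log_le K (by positivity)
  have hB0 : 0 < B := by linarith
  refine ⟨lam * L + c, by positivity, B * Real.exp (lam * L + d), by positivity,
    fun m m' hm => ?_⟩
  rw [expPhiStar, ENNReal.mul_iSup]
  refine iSup_le fun ⟨s, hs⟩ => ?_
  have hs : 0 ≤ s := hs
  have hlB : 0 ≤ Real.log B := Real.log_nonneg hB
  refine le_trans ?_ (mul_le_mul_right (ofReal_exp_le_expPhiStar ω lam m (add_nonneg hs hlB)) _)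
  rw [← ENNReal.ofReal_mul (by positivity), ← ENNReal.ofReal_mul (by positivity)]
  apply ENNReal.ofReal_le_ofReal
  have e1 : B ^ (m + 1) = B * Real.exp (m * Real.log B) := by
    rw [pow_succ', Real.exp_nat_mul, Real.exp_log hB0]
  have e2 : ω (Real.exp (s + Real.log B)) ≤ L * (ω (Real.exp s) + 1) := by
    rw [Real.exp_add, Real.exp_log hB0]
    exact hscale _ (Real.exp_pos s).le _ (by rw [mul_comm]) (by positivity)
  rw [e1, mul_assoc, mul_assoc, ← Real.exp_add, ← Real.exp_add]
  refine mul_le_mul_of_nonneg_left (Real.exp_le_exp.2 ?_) hB0.le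
  have h3 : (m' : ℝ) * s ≤ (m + K) * s := by
    gcongr
    exact_mod_cast hm
  have h4 := hlog s
  have h5 := mul_le_mul_of_nonneg_left e2 hlam.le
  nlinarith

/-- Domination of a family of reals by `e^{λφ*(deg/λ)}`, for every `λ > 0`. -/
def DominatedBy (ω : ℝ → ℝ) {ι : Type*} (d : ι → ℕ) (G : ι → ℝ) : Prop :=
  ∀ lam > (0 : ℝ), ∃ C > (0 : ℝ), ∀ i,
    ENNReal.ofReal (G i) ≤ ENNReal.ofReal C * expPhiStar ω lam (d i)

namespace DominatedBy

variable {ω : ℝ → ℝ} {ι κ : Type*} {d : ι → ℕ} {d' : κ → ℕ}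

lemma of_sup (hω : IsWeightFn ω) {G : ι → ℝ} {H : κ → ℝ} (hH : DominatedBy ω d' H) (B : ℝ)
    (K : ℕ) (hB : 1 ≤ B)
    (h : ∀ (i : ι) (M : ℝ≥0∞), (∀ j, d' j ≤ d i + K → ENNReal.ofReal (H j) ≤ M) →
      ENNReal.ofReal (G i) ≤ ENNReal.ofReal (B ^ (d i + 1)) * M) :
    DominatedBy ω d G := by
  intro lam hlam
  obtain ⟨mu, hmu, C, hC, hle⟩ := hω.exists_expPhiStar_le hB K hlam
  obtain ⟨C', hC', hH⟩ := hH mu hmu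
  refine ⟨C' * C, by positivity, fun i => ?_⟩
  have hmono : ∀ j, d' j ≤ d i + K → expPhiStar ω mu (d' j) ≤ expPhiStar ω mu (d i + K : ℕ) := by
    intro j hj
    refine iSup_mono fun ⟨s, hs⟩ => ?_
    have hs : 0 ≤ s := hs
    gcongr
  refine (h i _ fun j hj => (hH j).trans (mul_le_mul_right (hmono j hj) _)).trans ?_
  rw [mul_left_comm, ENNReal.ofReal_mul hC'.le, mul_assoc]
  exact mul_le_mul_right (hle _ _ le_rfl) _

lemma of_le (hω : IsWeightFn ω) {G : ι → ℝ} {H : κ → ℝ} (hH : DominatedBy ω d' H) (B : ℝ)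
    (K : ℕ) (hB : 1 ≤ B)
    (h : ∀ i, ∃ j, d' j ≤ d i + K ∧ G i ≤ B ^ (d i + 1) * H j) :
    DominatedBy ω d G := by
  refine hH.of_sup hω B K hB fun i M hM => ?_
  obtain ⟨j, hj, hle⟩ := h i
  calc ENNReal.ofReal (G i) ≤ ENNReal.ofReal (B ^ (d i + 1) * H j) := ENNReal.ofReal_le_ofReal hle
    _ = ENNReal.ofReal (B ^ (d i + 1)) * ENNReal.ofReal (H j) :=
      ENNReal.ofReal_mul (by positivity)
    _ ≤ _ := mul_le_mul_right (hM j hj) _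

lemma mono {G H : ι → ℝ} (hH : DominatedBy ω d H) (h : ∀ i, G i ≤ H i) : DominatedBy ω d G := by
  intro lam hlam
  obtain ⟨C, hC, hle⟩ := hH lam hlam
  exact ⟨C, hC, fun i => (ENNReal.ofReal_le_ofReal (h i)).trans (hle i)⟩

lemma add {G H : ι → ℝ} (hG : DominatedBy ω d G) (hH : DominatedBy ω d H) :
    DominatedBy ω d fun i => G i + H i := by
  intro lam hlam
  obtain ⟨C, hC, hle⟩ := hG lam hlam
  obtain ⟨C', hC', hle'⟩ := hH lam hlam
  refine ⟨C + C', by positivity, fun i => ?_⟩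
  rw [ENNReal.ofReal_add hC.le hC'.le, add_mul]
  exact ENNReal.ofReal_add_le.trans (add_le_add (hle i) (hle' i))

lemma sum {σ : Type*} (s : Finset σ) {G : σ → ι → ℝ} (h : ∀ k ∈ s, DominatedBy ω d (G k)) :
    DominatedBy ω d fun i => ∑ k ∈ s, G k i := by
  classical
  induction s using Finset.induction_on with
  | empty => exact fun lam _ => ⟨1, one_pos, fun i => by simp⟩
  | insert a s ha ih =>
    simp_rw [Finset.sum_insert ha]
    exact (h a (by simp)).add (ih fun k hk => h k (by simp [hk]))

end DominatedBy

lemma abs_xpow_le (β : Fin n → ℕ) (x : En n) : |xpow β x| ≤ ‖x‖ ^ ∑ i, β i := by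
  rw [xpow, Finset.abs_prod, ← Finset.prod_pow_eq_pow_sum]
  refine Finset.prod_le_prod (fun _ _ => abs_nonneg _) fun i _ => ?_
  rw [abs_pow]
  gcongr
  exact EuclideanSpace.norm_eq x ▸ PiLp.norm_apply_le x i

lemma xpow_single (i : Fin n) (m : ℕ) (x : En n) : xpow (Pi.single i m) x = x i ^ m := by
  rw [xpow, Finset.prod_eq_single i]
  · simp
  · intro j _ hj
    simp [hj]
  · simp

lemma eq_zero_or_norm_le (x : En n) : x = 0 ∨ ∃ i, ‖x‖ ≤ (n + 1) * |x i| := by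
  rcases isEmpty_or_nonempty (Fin n) with h | h
  · exact Or.inl (Subsingleton.elim _ _)
  · right
    obtain ⟨i, hi⟩ := Finite.exists_max fun i => |x i|
    refine ⟨i, ?_⟩
    rw [EuclideanSpace.norm_eq, Real.sqrt_le_iff]
    refine ⟨by positivity, ?_⟩
    calc ∑ j, ‖x j‖ ^ 2 ≤ ∑ _j : Fin n, |x i| ^ 2 := by
          gcongr with j
          exact hi j
      _ = n * |x i| ^ 2 := by simp
      _ ≤ (n + 1) ^ 2 * |x i| ^ 2 := by
          gcongr
          nlinarith [(Nat.cast_nonneg n : (0 : ℝ) ≤ n)]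
      _ = _ := by ring

lemma ConvexOn.exists_affine_le {f : ℝ → ℝ} {s : Set ℝ} (hf : ConvexOn ℝ s f) {t : ℝ}
    (ht : t ∈ interior s) : ∃ p, ∀ y ∈ s, f t + p * (y - t) ≤ f y := by
  refine ⟨derivWithin f (Set.Ioi t) t, fun y hy => ?_⟩
  rcases lt_trichotomy y t with h | h | h
  · have h1 := (hf.slope_le_leftDeriv_of_mem_interior hy ht h).trans
      (hf.leftDeriv_le_rightDeriv_of_mem_interior ht)
    rw [slope_def_field, div_le_iff₀ (by linarith)] at h1
    linarith
  · simp [h]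
  · have h1 := hf.rightDeriv_le_slope_of_mem_interior ht hy h
    rw [slope_def_field, le_div_iff₀ (by linarith)] at h1
    linarith

lemma IsWeightFn.exists_expPhiStar_nat_le {ω : ℝ → ℝ} (hω : IsWeightFn ω) {mu : ℝ} (hmu : 0 < mu)
    {r : ℝ} (hr : 1 < r) :
    ∃ m : ℕ, expPhiStar ω mu m ≤ ENNReal.ofReal (r ^ (m + 1) * Real.exp (-(mu * ω r))) := by
  have hr0 : 0 < r := by linarith
  have ht : 0 < Real.log r := Real.log_pos hr
  obtain ⟨p, hp⟩ := hω.delta.exists_affine_le (t := Real.log r) (by simpa using ht)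
  simp only [Real.exp_log hr0, Set.mem_Ici] at hp
  have hp0 : 0 ≤ p := by
    have h0 := hp 0 le_rfl
    rw [Real.exp_zero] at h0
    have h1 : ω 1 ≤ ω r := hω.mono (by simp) hr0.le hr.le
    by_contra! hneg
    nlinarith
  refine ⟨⌊mu * p⌋₊, iSup_le fun ⟨s, hs⟩ => ENNReal.ofReal_le_ofReal ?_⟩
  have hs : 0 ≤ s := hs
  have h1 : (⌊mu * p⌋₊ : ℝ) ≤ mu * p := Nat.floor_le (by positivity)
  have h2 : mu * p < ⌊mu * p⌋₊ + 1 := Nat.lt_floor_add_one _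
  have e1 : r ^ (⌊mu * p⌋₊ + 1) = Real.exp ((⌊mu * p⌋₊ + 1) * Real.log r) := by
    rw [← Nat.cast_succ, Real.exp_nat_mul, Real.exp_log hr0]
  rw [e1, ← Real.exp_add]
  gcongr
  have h3 := mul_le_mul_of_nonneg_left (hp s hs) hmu.le
  have h4 := mul_le_mul_of_nonneg_right h1 hs
  have h5 := mul_le_mul_of_nonneg_right h2.le ht.le
  nlinarith

lemma dominatedBy_xpow_of_decay {ω : ℝ → ℝ} (hω : IsWeightFn ω) {F : En n → ℝ}
    (hF : ∀ x, 0 ≤ F x) (h : ∀ lam > (0 : ℝ), ∃ C, ∀ x, Real.exp (lam * ω ‖x‖) * F x ≤ C) :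
    DominatedBy ω (fun p : (Fin n → ℕ) × En n => ∑ i, p.1 i)
      fun p => |xpow p.1 p.2| * F p.2 := by
  intro mu hmu
  obtain ⟨C, hC⟩ := h mu hmu
  have hC0 : 0 ≤ C := le_trans (mul_nonneg (Real.exp_pos _).le (hF 0)) (hC 0)
  have hω1 : 0 ≤ ω 1 := hω.nonneg 1 zero_le_one
  refine ⟨(C + 1) * Real.exp (mu * ω 1), by positivity, fun ⟨β, x⟩ => ?_⟩
  dsimp only
  have hFx : F x ≤ C * Real.exp (-(mu * ω ‖x‖)) := by
    rw [Real.exp_neg, ← div_eq_mul_inv, le_div_iff₀ (Real.exp_pos _), mul_comm]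
    exact hC x
  have hE : 1 ≤ Real.exp (mu * ω 1) := Real.one_le_exp (by positivity)
  have hle := mul_le_mul (abs_xpow_le β x) hFx (hF x) (by positivity)
  generalize ∑ i, β i = m at hle ⊢
  have hωx : 0 ≤ ω ‖x‖ := hω.nonneg _ (norm_nonneg x)
  rcases lt_or_ge ‖x‖ 1 with hx | hx
  · refine le_trans ?_ (mul_le_mul_right (ofReal_exp_le_expPhiStar ω mu m le_rfl) _)
    rw [← ENNReal.ofReal_mul (by positivity)]
    apply ENNReal.ofReal_le_ofReal
    rw [mul_assoc, ← Real.exp_add, Real.exp_zero]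
    simp only [mul_zero, zero_sub, add_neg_cancel, Real.exp_zero, mul_one]
    refine hle.trans ?_
    have h1 : ‖x‖ ^ m ≤ 1 := pow_le_one₀ (norm_nonneg x) hx.le
    have h2 : Real.exp (-(mu * ω ‖x‖)) ≤ 1 := by
      rw [Real.exp_le_one_iff]
      nlinarith
    calc ‖x‖ ^ m * (C * Real.exp (-(mu * ω ‖x‖))) ≤ 1 * (C * 1) := by gcongr
      _ ≤ C + 1 := by linarith
  · have hx0 : 0 < ‖x‖ := by linarith
    refine le_trans ?_ (mul_le_mul_right
      (ofReal_exp_le_expPhiStar ω mu m (Real.log_nonneg hx)) _)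
    rw [← ENNReal.ofReal_mul (by positivity)]
    apply ENNReal.ofReal_le_ofReal
    rw [Real.exp_log hx0, sub_eq_add_neg, Real.exp_add, Real.exp_nat_mul, Real.exp_log hx0]
    refine hle.trans ?_
    rw [mul_left_comm]
    refine mul_le_mul_of_nonneg_right ?_ (by positivity)
    nlinarith

lemma decay_of_dominatedBy_xpow {ω : ℝ → ℝ} (hω : IsWeightFn ω) {F : En n → ℝ}
    (hF : ∀ x, 0 ≤ F x) (h : DominatedBy ω (fun p : (Fin n → ℕ) × En n => ∑ i, p.1 i)
      fun p => |xpow p.1 p.2| * F p.2) (lam : ℝ) (hlam : 0 < lam) :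
    ∃ C, ∀ x, Real.exp (lam * ω ‖x‖) * F x ≤ C := by
  have hA : (1 : ℝ) ≤ n + 1 := by simp
  set A : ℝ := n + 1
  have hA0 : 0 < A := by linarith
  obtain ⟨L, hL, hscale⟩ := hω.exists_scale A
  obtain ⟨c, hc, d, hlog⟩ := hω.exists_log_le 1 zero_le_one
  obtain ⟨C, hC, hCle⟩ := h (lam * L + c) (by positivity)
  obtain ⟨D, hD, hDle⟩ := h 1 one_pos
  refine ⟨max (C * Real.exp (lam * L + d)) (Real.exp (lam * ω A) * D), fun x => ?_⟩
  rcases le_or_gt ‖x‖ A with hx | hx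
  · refine le_max_of_le_right ?_
    have hFx : F x ≤ D := by
      have h0 := hDle (0, x)
      have h1 : expPhiStar ω 1 (0 : ℕ) ≤ 1 := by
        refine iSup_le fun ⟨s, hs⟩ => ?_
        have := hω.nonneg _ (Real.exp_pos s).le
        simp [this]
      simp only [xpow, Pi.zero_apply, pow_zero, Finset.prod_const_one, abs_one, one_mul,
        Finset.sum_const_zero] at h0
      have h2 := h0.trans (mul_le_mul_right h1 _)
      rw [mul_one] at h2
      exact (ENNReal.ofReal_le_ofReal_iff hD.le).1 h2
    gcongr
    · exact hF x
    · exact hω.mono (norm_nonneg x) hA0.le hx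
  · refine le_max_of_le_left ?_
    set r := ‖x‖ / A with hr
    have hr1 : 1 < r := by rwa [hr, one_lt_div hA0]
    have hr0 : 0 < r := by linarith
    obtain ⟨m, hm⟩ := hω.exists_expPhiStar_nat_le (mu := lam * L + c) (by positivity) hr1
    obtain ⟨i, hi⟩ := (eq_zero_or_norm_le x).resolve_left (by
      rintro rfl
      rw [norm_zero] at hx
      linarith)
    have hri : r ≤ |x i| := by
      rw [hr, div_le_iff₀ hA0, mul_comm]
      exact hi
    have h1 := hCle (Pi.single i m, x)
    simp only [xpow_single, Finset.sum_pi_single', Finset.mem_univ, if_true, abs_pow] at h1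
    have h2 := h1.trans (mul_le_mul_right hm _)
    rw [← ENNReal.ofReal_mul hC.le, ENNReal.ofReal_le_ofReal_iff (by positivity)] at h2
    have h3 : r ^ m * F x ≤ r ^ m * (C * (r * Real.exp (-((lam * L + c) * ω r)))) := by
      calc r ^ m * F x ≤ |x i| ^ m * F x := by
            gcongr
            exact hF x
        _ ≤ _ := h2
        _ = _ := by ring
    have h4 := le_of_mul_le_mul_left h3 (by positivity)
    have h5 : r ≤ Real.exp (c * ω r + d) := by
      have := hlog (Real.log r)
      rw [Real.exp_log hr0, one_mul] at this
      exact (Real.log_le_iff_le_exp hr0).1 this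
    have h6 : ω ‖x‖ ≤ L * (ω r + 1) :=
      hscale r hr0.le _ (by rw [hr]; field_simp; rfl) (norm_nonneg x)
    calc Real.exp (lam * ω ‖x‖) * F x
        ≤ Real.exp (lam * (L * (ω r + 1))) *
          (C * (Real.exp (c * ω r + d) * Real.exp (-((lam * L + c) * ω r)))) := by
          gcongr
          · exact hF x
          · exact h4.trans (by gcongr)
      _ = C * (Real.exp (lam * (L * (ω r + 1))) *
          (Real.exp (c * ω r + d) * Real.exp (-((lam * L + c) * ω r)))) := by ring
      _ = C * Real.exp (lam * L + d) := by
          rw [← Real.exp_add, ← Real.exp_add]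
          ring_nf
      _ ≤ _ := le_rfl

/-- The composition `T₀^{α₀} ∘ ⋯ ∘ T_{n-1}^{α_{n-1}}`. -/
def opPow {M : Type*} (T : Fin n → M → M) (α : Fin n → ℕ) (f : M) : M :=
  (List.finRange n).foldr (fun i g => (T i)^[α i] g) f

lemma opPow_semiconj {M N : Type*} {T : Fin n → M → M} {S : Fin n → N → N} {Φ : M → N}
    (h : ∀ i f, Φ (T i f) = S i (Φ f)) (α : Fin n → ℕ) (f : M) :
    Φ (opPow T α f) = opPow S α (Φ f) := by
  unfold opPow
  induction List.finRange n with
  | nil => rfl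
  | cons i l ih =>
    simp only [List.foldr_cons, ← ih]
    exact (Function.Semiconj.iterate_right (f := Φ) (h i) (α i)) _

lemma opPow_induction {M : Type*} {T : Fin n → M → M} {P : M → Prop}
    (h : ∀ i f, P f → P (T i f)) (α : Fin n → ℕ) {f : M} (hf : P f) : P (opPow T α f) := by
  unfold opPow
  induction List.finRange n with
  | nil => exact hf
  | cons i l ih =>
    rw [List.foldr_cons]
    induction α i with
    | zero => exact ih
    | succ k hk =>
      rw [Function.iterate_succ_apply']
      exact h i _ hk

lemma opPow_const_smul {M : Type*} [AddCommGroup M] [Module ℂ M] (T : Fin n → M →ₗ[ℂ] M)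
    (c : ℂ) (α : Fin n → ℕ) (f : M) :
    opPow (fun i g => c • T i g) α f = c ^ (∑ i, α i) • opPow (fun i => T i) α f := by
  have key : ∀ (i : Fin n) (k : ℕ) (a : ℂ) (g : M),
      (fun g => c • T i g)^[k] (a • g) = (c ^ k * a) • (T i)^[k] g := by
    intro i k a g
    induction k with
    | zero => simp
    | succ k ih =>
      rw [Function.iterate_succ_apply', Function.iterate_succ_apply', ih, map_smul, smul_smul,
        pow_succ']
      ring_nf
  have : ∀ l : List (Fin n), l.foldr (fun i g => (fun g => c • T i g)^[α i] g) f =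
      c ^ (l.map α).sum • l.foldr (fun i g => (T i)^[α i] g) f := by
    intro l
    induction l with
    | nil => simp
    | cons i l ih =>
      simp only [List.foldr_cons, List.map_cons, List.sum_cons, pow_add]
      rw [ih, key]
  rw [opPow, this, ← List.sum_ofFn, List.ofFn_eq_map]
  rfl

lemma opPow_mul_eq (x : En n) (β : Fin n → ℕ) (c : ℂ) :
    opPow (fun i (c : ℂ) => (x i : ℂ) * c) β c = (xpow β x : ℂ) * c := by
  have key : ∀ l : List (Fin n), l.foldr (fun i g => (fun c : ℂ => (x i : ℂ) * c)^[β i] g) c =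
      (l.map fun i => (x i : ℂ) ^ β i).prod * c := by
    intro l
    induction l with
    | nil => simp
    | cons i l ih =>
      rw [List.foldr_cons, ih, mul_left_iterate, List.map_cons, List.prod_cons, mul_assoc]
  rw [opPow, key, xpow, ← List.ofFn_eq_map, List.prod_ofFn]
  push_cast
  rfl

open scoped LineDeriv FourierTransform

/-- The partial derivative `∂_i` on Schwartz functions. -/
def schwartzPartial (i : Fin n) : 𝓢(En n, ℂ) →ₗ[ℂ] 𝓢(En n, ℂ) :=
  (LineDeriv.lineDerivOpCLM ℂ 𝓢(En n, ℂ) (EuclideanSpace.single i (1 : ℝ))).toLinearMap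

/-- Multiplication by the coordinate `x_i` on Schwartz functions. -/
def schwartzCoord (i : Fin n) : 𝓢(En n, ℂ) →ₗ[ℂ] 𝓢(En n, ℂ) where
  toFun f := smulLeftCLM ℂ (fun x : En n => inner ℝ x (EuclideanSpace.single i (1 : ℝ))) f
  map_add' f g := map_add _ _ _
  map_smul' c f := by
    have : (fun x : En n => inner ℝ x (EuclideanSpace.single i (1 : ℝ))).HasTemperateGrowth := by
      fun_prop
    ext x
    simp [this, mul_left_comm]

lemma schwartzPartial_apply (i : Fin n) (f : 𝓢(En n, ℂ)) (x : En n) :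
    schwartzPartial i f x = fderiv ℝ f x (EuclideanSpace.single i 1) := rfl

lemma schwartzCoord_apply (i : Fin n) (f : 𝓢(En n, ℂ)) (x : En n) :
    schwartzCoord i f x = x i * f x := by
  have : (fun x : En n => inner ℝ x (EuclideanSpace.single i (1 : ℝ))).HasTemperateGrowth := by
    fun_prop
  refine (smulLeftCLM_apply_apply this f x).trans ?_
  simp [EuclideanSpace.inner_single_right]

/-- `∂^α` on Schwartz functions. -/
def schwartzPartials (α : Fin n → ℕ) : 𝓢(En n, ℂ) → 𝓢(En n, ℂ) :=
  opPow (fun i => schwartzPartial i) α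

/-- Multiplication by `x^β` on Schwartz functions. -/
def schwartzMonomial (β : Fin n → ℕ) : 𝓢(En n, ℂ) → 𝓢(En n, ℂ) :=
  opPow (fun i => schwartzCoord i) β

lemma mpderiv_coe (α : Fin n → ℕ) (f : 𝓢(En n, ℂ)) :
    mpderiv α ⇑f = ⇑(schwartzPartials α f) :=
  (opPow_semiconj (T := fun i => schwartzPartial i) (S := pderivE)
    (Φ := fun f : 𝓢(En n, ℂ) => ⇑f) (fun _ _ => rfl) α f).symm

lemma schwartzMonomial_apply (β : Fin n → ℕ) (f : 𝓢(En n, ℂ)) (x : En n) :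
    schwartzMonomial β f x = xpow β x * f x := by
  rw [← opPow_mul_eq]
  exact opPow_semiconj (Φ := fun f : 𝓢(En n, ℂ) => f x) (fun i f => schwartzCoord_apply i f x) β f

lemma norm_schwartzMonomial_apply (β : Fin n → ℕ) (f : 𝓢(En n, ℂ)) (x : En n) :
    ‖schwartzMonomial β f x‖ = |xpow β x| * ‖f x‖ := by
  rw [schwartzMonomial_apply, norm_mul, Complex.norm_real, Real.norm_eq_abs]

lemma xpow_add_single (β : Fin n → ℕ) (i : Fin n) (m : ℕ) (x : En n) :
    xpow (β + Pi.single i m) x = xpow β x * x i ^ m := by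
  rw [← xpow_single, xpow, xpow, xpow, ← Finset.prod_mul_distrib]
  simp [pow_add]

lemma schwartzMonomial_coord (β : Fin n → ℕ) (i : Fin n) (f : 𝓢(En n, ℂ)) :
    schwartzMonomial β (schwartzCoord i f) = schwartzMonomial (β + Pi.single i 1) f := by
  ext x
  simp only [schwartzMonomial_apply, schwartzCoord_apply, xpow_add_single]
  push_cast
  ring

lemma schwartzMonomial_zero (f : 𝓢(En n, ℂ)) : schwartzMonomial 0 f = f := by
  ext x
  simp [schwartzMonomial_apply, xpow]

lemma schwartzPartial_coord (i j : Fin n) (f : 𝓢(En n, ℂ)) :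
    schwartzPartial j (schwartzCoord i f) =
      schwartzCoord i (schwartzPartial j f) + if i = j then f else 0 := by
  ext x
  have hco : ⇑(schwartzCoord i f) =
      fun x : En n => ((EuclideanSpace.proj i : En n →L[ℝ] ℝ) x) • f x := by
    ext x
    simp [schwartzCoord_apply]
  have h := (EuclideanSpace.proj i : En n →L[ℝ] ℝ).hasFDerivAt.fun_smul (f.hasFDerivAt x)
  rw [schwartzPartial_apply, hco, h.fderiv]
  by_cases hij : i = j
  · subst hij
    simp [schwartzCoord_apply, schwartzPartial_apply]
  · simp [schwartzCoord_apply, schwartzPartial_apply, hij]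

lemma iterate_schwartzPartial_coord_self (i : Fin n) (k : ℕ) (f : 𝓢(En n, ℂ)) :
    (schwartzPartial i)^[k] (schwartzCoord i f) =
      schwartzCoord i ((schwartzPartial i)^[k] f) + (k : ℂ) • (schwartzPartial i)^[k - 1] f := by
  induction k with
  | zero => simp
  | succ k ih =>
    rw [Function.iterate_succ_apply', ih, map_add, schwartzPartial_coord, if_pos rfl, map_smul,
      ← Function.iterate_succ_apply' (schwartzPartial i) k,
      ← Function.iterate_succ_apply' (schwartzPartial i) (k - 1)]
    rcases k with _ | k
    · simp
    · simp only [Nat.add_sub_cancel, Nat.succ_eq_add_one]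
      push_cast
      module

lemma iterate_schwartzPartial_coord_of_ne {i j : Fin n} (hij : i ≠ j) (k : ℕ)
    (f : 𝓢(En n, ℂ)) :
    (schwartzPartial j)^[k] (schwartzCoord i f) = schwartzCoord i ((schwartzPartial j)^[k] f) := by
  refine (Function.Commute.iterate_left (f := schwartzPartial j) (g := schwartzCoord i)
    (fun f => ?_) k) f
  rw [schwartzPartial_coord, if_neg hij, add_zero]

lemma schwartzPartials_coord (α : Fin n → ℕ) (i : Fin n) (f : 𝓢(En n, ℂ)) :
    schwartzPartials α (schwartzCoord i f) = schwartzCoord i (schwartzPartials α f) +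
      (α i : ℂ) • schwartzPartials (Function.update α i (α i - 1)) f := by
  have key : ∀ l : List (Fin n), l.Nodup →
      l.foldr (fun j g => (schwartzPartial j)^[α j] g) (schwartzCoord i f) =
        schwartzCoord i (l.foldr (fun j g => (schwartzPartial j)^[α j] g) f) +
        if i ∈ l then (α i : ℂ) • l.foldr
          (fun j g => (schwartzPartial j)^[Function.update α i (α i - 1) j] g) f else 0 := by
    intro l hl
    induction l with
    | nil => simp
    | cons j l ih =>
      rw [List.nodup_cons] at hl
      simp only [List.foldr_cons]
      rw [ih hl.2]
      by_cases hij : i = j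
      · subst hij
        rw [if_neg hl.1, add_zero, iterate_schwartzPartial_coord_self, if_pos (by simp),
          Function.update_self]
        congr 3
        refine List.foldr_ext _ _ _ fun j hj g => ?_
        rw [Function.update_of_ne (by rintro rfl; exact hl.1 hj)]
      · rw [iterate_map_add, iterate_schwartzPartial_coord_of_ne hij,
          Function.update_of_ne (Ne.symm hij)]
        by_cases hi : i ∈ l
        · rw [if_pos hi, if_pos (by simp [hi])]
          congr 1
          exact (Function.Commute.iterate_left (f := schwartzPartial j)
            (g := fun g => (α i : ℂ) • g) (fun g => map_smul _ _ g) _) _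
        · rw [if_neg hi, if_neg (by simp [hi, hij]), iterate_map_zero]
  have h := key _ (List.nodup_finRange n)
  rwa [if_pos (List.mem_finRange i)] at h

/-- The Fourier transform `û(ξ) = ∫ e^{-i⟨x,ξ⟩} u(x) dx` of a Schwartz function. -/
def schwartzFT (f : 𝓢(En n, ℂ)) : 𝓢(En n, ℂ) :=
  compCLMOfContinuousLinearEquiv ℂ
    (ContinuousLinearEquiv.smulLeft (Units.mk0 ((2 * π)⁻¹ : ℝ) (by positivity))) (𝓕 f)

lemma schwartzFT_apply (f : 𝓢(En n, ℂ)) (ξ : En n) :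
    schwartzFT f ξ = 𝓕 f ((2 * π)⁻¹ • ξ) := rfl

lemma FTn_coe (f : 𝓢(En n, ℂ)) : FTn ⇑f = ⇑(schwartzFT f) := by
  ext ξ
  rw [schwartzFT_apply, fourier_coe, Real.fourier_eq', FTn]
  congr 1
  ext x
  rw [smul_eq_mul]
  congr 2
  rw [real_inner_smul_right, PiLp.inner_apply]
  have : (π : ℂ) ≠ 0 := by exact_mod_cast Real.pi_ne_zero
  simp only [RCLike.inner_apply, conj_trivial]
  push_cast
  simp_rw [mul_comm (Complex.ofReal (ξ.ofLp _))]
  field_simp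

lemma schwartzPartial_schwartzFT (i : Fin n) (f : 𝓢(En n, ℂ)) :
    schwartzPartial i (schwartzFT f) = schwartzFT (-Complex.I • schwartzCoord i f) := by
  have h : ∂_{EuclideanSpace.single i (1 : ℝ)} (𝓕 f) =
      𝓕 (-(2 * π * Complex.I) • schwartzCoord i f) := lineDerivOp_fourier_eq f _
  have h2 : schwartzPartial i (schwartzFT f) = compCLMOfContinuousLinearEquiv ℂ
      (ContinuousLinearEquiv.smulLeft (Units.mk0 ((2 * π)⁻¹ : ℝ) (by positivity)))
      (∂_{(2 * π)⁻¹ • EuclideanSpace.single i (1 : ℝ)} (𝓕 f)) :=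
    lineDerivOp_compCLMOfContinuousLinearEquiv _ _ _ _
  rw [h2, LineDeriv.lineDerivOp_left_smul, h]
  ext ξ
  have : (π : ℂ) ≠ 0 := by exact_mod_cast Real.pi_ne_zero
  rw [schwartzFT_apply, FourierTransform.fourier_smul, FourierTransform.fourier_smul]
  change ((2 * π)⁻¹ : ℝ) • (-(2 * π * Complex.I) * 𝓕 (schwartzCoord i f) ((2 * π)⁻¹ • ξ)) =
    -Complex.I * 𝓕 (schwartzCoord i f) ((2 * π)⁻¹ • ξ)
  rw [Complex.real_smul]
  push_cast
  field_simp

lemma schwartzCoord_schwartzFT (i : Fin n) (f : 𝓢(En n, ℂ)) :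
    schwartzCoord i (schwartzFT f) = schwartzFT (-Complex.I • schwartzPartial i f) := by
  have h : 𝓕 (schwartzPartial i f) = (2 * π * Complex.I) • schwartzCoord i (𝓕 f) :=
    fourier_lineDerivOp_eq f _
  ext ξ
  have : (π : ℂ) ≠ 0 := by exact_mod_cast Real.pi_ne_zero
  rw [schwartzCoord_apply, schwartzFT_apply, schwartzFT_apply, FourierTransform.fourier_smul, h]
  simp [schwartzCoord_apply]
  field_simp
  simp

lemma norm_xpow_mul_schwartzPartials_schwartzFT (α β : Fin n → ℕ) (f : 𝓢(En n, ℂ)) (ξ : En n) :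
    |xpow α ξ| * ‖schwartzPartials β (schwartzFT f) ξ‖ =
      ‖schwartzFT (schwartzPartials α (schwartzMonomial β f)) ξ‖ := by
  have h1 : schwartzPartials β (schwartzFT f) =
      schwartzFT ((-Complex.I) ^ (∑ i, β i) • schwartzMonomial β f) := by
    rw [schwartzMonomial, ← opPow_const_smul]
    exact (opPow_semiconj (Φ := schwartzFT)
      (fun i f => (schwartzPartial_schwartzFT i f).symm) β f).symm
  have h2 : ∀ g : 𝓢(En n, ℂ), schwartzMonomial α (schwartzFT g) =
      schwartzFT ((-Complex.I) ^ (∑ i, α i) • schwartzPartials α g) := by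
    intro g
    rw [schwartzPartials, ← opPow_const_smul]
    exact (opPow_semiconj (Φ := schwartzFT)
      (fun i f => (schwartzCoord_schwartzFT i f).symm) α g).symm
  have h3 : ∀ (c : ℂ) (g : 𝓢(En n, ℂ)), schwartzFT (c • g) = c • schwartzFT g := by
    intro c g
    ext ξ
    rw [schwartzFT_apply, FourierTransform.fourier_smul]
    rfl
  rw [h1, h3, smul_apply, norm_smul, norm_pow, norm_neg, Complex.norm_I, one_pow, one_mul,
    ← norm_schwartzMonomial_apply, h2, h3, smul_apply, norm_smul, norm_pow, norm_neg,
    Complex.norm_I, one_pow, one_mul]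

lemma exists_integral_norm_le (n : ℕ) : ∃ C ≥ (1 : ℝ), ∀ (g : 𝓢(En n, ℂ)) (M : ℝ≥0∞),
    (∀ x, ENNReal.ofReal ((1 + ‖x‖) ^ (n + 1) * ‖g x‖) ≤ M) →
      ENNReal.ofReal (∫ x, ‖g x‖) ≤ ENNReal.ofReal C * M := by
  have hint : Integrable (fun x : En n => (1 + ‖x‖) ^ (-((n : ℝ) + 1))) :=
    integrable_one_add_norm (by simp)
  have hI : 0 ≤ ∫ x : En n, (1 + ‖x‖) ^ (-((n : ℝ) + 1)) :=
    integral_nonneg fun x => by positivity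
  refine ⟨(∫ x : En n, (1 + ‖x‖) ^ (-((n : ℝ) + 1))) + 1, by linarith, fun g M hM => ?_⟩
  rcases eq_or_ne M ⊤ with rfl | hMtop
  · rw [ENNReal.mul_top (ENNReal.ofReal_pos.2 (by linarith)).ne']
    exact le_top
  lift M to NNReal using hMtop
  rw [← ENNReal.ofReal_coe_nnreal (p := M), ← ENNReal.ofReal_mul (by linarith)]
  apply ENNReal.ofReal_le_ofReal
  calc ∫ x, ‖g x‖ ≤ ∫ x : En n, (1 + ‖x‖) ^ (-((n : ℝ) + 1)) * (M : ℝ) := by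
        refine integral_mono g.integrable.norm (hint.mul_const _) fun x => ?_
        have h1 := hM x
        rw [← ENNReal.ofReal_coe_nnreal (p := M),
          ENNReal.ofReal_le_ofReal_iff M.coe_nonneg] at h1
        have h2 : 0 < 1 + ‖x‖ := by positivity
        dsimp only
        rw [Real.rpow_neg h2.le, ← Nat.cast_succ, Real.rpow_natCast, ← div_eq_inv_mul,
          le_div_iff₀ (by positivity), mul_comm]
        exact h1
    _ = (∫ x : En n, (1 + ‖x‖) ^ (-((n : ℝ) + 1))) * M := integral_mul_const _ _
    _ ≤ _ := by
        gcongr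
        linarith

lemma norm_schwartzFT_le (g : 𝓢(En n, ℂ)) (ξ : En n) : ‖schwartzFT g ξ‖ ≤ ∫ x, ‖g x‖ :=
  VectorFourier.norm_fourierIntegral_le_integral_norm _ _ _ _ _

lemma norm_le_integral_fourier (g : 𝓢(En n, ℂ)) (x : En n) : ‖g x‖ ≤ ∫ ξ, ‖𝓕 g ξ‖ := by
  have h : g x = 𝓕 (𝓕 g) (-x) := by
    have h0 : 𝓕⁻ (𝓕 g) = g := FourierTransform.fourierInv_fourier_eq g
    rw [fourierInv_apply_eq] at h0
    exact (DFunLike.congr_fun h0 x).symm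
  rw [h]
  exact VectorFourier.norm_fourierIntegral_le_integral_norm _ _ _ _ _

lemma norm_fourier_weight_le (g : 𝓢(En n, ℂ)) (N : ℕ) (ξ : En n) :
    (1 + ‖ξ‖) ^ N * ‖𝓕 g ξ‖ ≤
      (1 + ‖(2 * π) • ξ‖) ^ N * ‖schwartzFT g ((2 * π) • ξ)‖ := by
  have h1 : (1 : ℝ) ≤ 2 * π := by linarith [Real.pi_gt_three]
  rw [schwartzFT_apply, inv_smul_smul₀ (by positivity)]
  gcongr
  rw [norm_smul, Real.norm_of_nonneg (by positivity)]
  exact le_mul_of_one_le_left (norm_nonneg ξ) h1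

lemma one_add_norm_pow_le (N : ℕ) (x : En n) :
    (1 + ‖x‖) ^ N ≤ (2 * (n + 1)) ^ N * (1 + ∑ i, |x i| ^ N) := by
  have hs : 0 ≤ ∑ i, |x i| ^ N := Finset.sum_nonneg fun _ _ => by positivity
  have hn : (0 : ℝ) ≤ n := n.cast_nonneg
  by_cases hx : ‖x‖ ≤ 1
  · calc (1 + ‖x‖) ^ N ≤ (2 * (n + 1)) ^ N := by
          gcongr
          linarith
      _ ≤ _ := le_mul_of_one_le_right (by positivity) (by linarith)
  · obtain ⟨i, hi⟩ := (eq_zero_or_norm_le x).resolve_left (by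
      rintro rfl
      simp at hx)
    calc (1 + ‖x‖) ^ N ≤ (2 * (n + 1) * |x i|) ^ N := by
          gcongr
          linarith
      _ = (2 * (n + 1)) ^ N * |x i| ^ N := mul_pow _ _ _
      _ ≤ _ := by
          gcongr
          have := Finset.single_le_sum (f := fun i => |x i| ^ N) (fun _ _ => by positivity)
            (Finset.mem_univ i)
          linarith

lemma DominatedBy.one_add_norm_pow_mul {ω : ℝ → ℝ} (hω : IsWeightFn ω) {ι : Type*} {d : ι → ℕ}
    {F : ι → ℝ} {y : ι → En n} (N : ℕ) (hF0 : ∀ j, 0 ≤ F j) (hF : DominatedBy ω d F)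
    (hc : ∀ k, DominatedBy ω d fun j => |y j k| ^ N * F j) :
    DominatedBy ω d fun j => (1 + ‖y j‖) ^ N * F j := by
  have hB : (1 : ℝ) ≤ (2 * (n + 1)) ^ N :=
    one_le_pow₀ (by linarith [(n.cast_nonneg : (0 : ℝ) ≤ n)])
  have hsum : DominatedBy ω d fun j => F j + ∑ k, |y j k| ^ N * F j :=
    hF.add (DominatedBy.sum Finset.univ fun k _ => hc k)
  refine hsum.of_le hω ((2 * (n + 1)) ^ N) 0 hB fun j => ⟨j, le_rfl, ?_⟩
  have h0 : 0 ≤ F j + ∑ k, |y j k| ^ N * F j :=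
    add_nonneg (hF0 j) (Finset.sum_nonneg fun k _ => mul_nonneg (by positivity) (hF0 j))
  calc (1 + ‖y j‖) ^ N * F j ≤ ((2 * (n + 1)) ^ N * (1 + ∑ k, |y j k| ^ N)) * F j :=
        mul_le_mul_of_nonneg_right (one_add_norm_pow_le N (y j)) (hF0 j)
    _ = (2 * (n + 1)) ^ N * (F j + ∑ k, |y j k| ^ N * F j) := by
        rw [← Finset.sum_mul]
        ring
    _ ≤ _ := mul_le_mul_of_nonneg_right (le_self_pow₀ hB (by omega)) h0

/-- `sup_x |x^β ∂^α f(x)|` is dominated by `e^{λφ*(|α|/λ)}`, for each `β`. -/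
def DerivDominated (ω : ℝ → ℝ) (f : 𝓢(En n, ℂ)) : Prop :=
  ∀ β : Fin n → ℕ, DominatedBy ω (fun p : (Fin n → ℕ) × En n => ∑ i, p.1 i)
    fun p => |xpow β p.2| * ‖schwartzPartials p.1 f p.2‖

/-- `sup_x |∂^α (x^β f)(x)|` is dominated by `e^{λφ*(|α|/λ)}`, for each `β`. -/
def DerivMonomialDominated (ω : ℝ → ℝ) (f : 𝓢(En n, ℂ)) : Prop :=
  ∀ β : Fin n → ℕ, DominatedBy ω (fun p : (Fin n → ℕ) × En n => ∑ i, p.1 i)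
    fun p => ‖schwartzPartials p.1 (schwartzMonomial β f) p.2‖

/-- `sup_x |x^β ∂^α f(x)|` is dominated by `e^{λφ*(|β|/λ)}`, for each `α`. -/
def MonomialDominated (ω : ℝ → ℝ) (f : 𝓢(En n, ℂ)) : Prop :=
  ∀ α : Fin n → ℕ, DominatedBy ω (fun p : (Fin n → ℕ) × En n => ∑ i, p.1 i)
    fun p => |xpow p.1 p.2| * ‖schwartzPartials α f p.2‖

lemma sum_update_pred_le (α : Fin n → ℕ) (i : Fin n) :
    ∑ j, Function.update α i (α i - 1) j ≤ ∑ j, α j := by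
  refine Finset.sum_le_sum fun j _ => ?_
  by_cases hj : j = i
  · subst hj
    simp
  · simp [hj]

lemma natCast_apply_le_two_pow (α : Fin n → ℕ) (i : Fin n) :
    (α i : ℝ) ≤ 2 ^ (∑ j, α j + 1) := by
  have h1 : α i ≤ ∑ j, α j := Finset.single_le_sum (fun _ _ => Nat.zero_le _) (Finset.mem_univ i)
  have h2 : ∑ j, α j + 1 < 2 ^ (∑ j, α j + 1) := Nat.lt_two_pow_self
  exact_mod_cast (by omega : α i ≤ 2 ^ (∑ j, α j + 1))

lemma DerivDominated.coord {ω : ℝ → ℝ} (hω : IsWeightFn ω) (i : Fin n) {f : 𝓢(En n, ℂ)}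
    (hf : DerivDominated ω f) : DerivDominated ω (schwartzCoord i f) := by
  intro β
  have h2 : DominatedBy ω (fun p : (Fin n → ℕ) × En n => ∑ i, p.1 i) fun p =>
      (p.1 i : ℝ) * (|xpow β p.2| *
        ‖schwartzPartials (Function.update p.1 i (p.1 i - 1)) f p.2‖) := by
    refine (hf β).of_le hω 2 0 one_le_two fun ⟨α, x⟩ =>
      ⟨(Function.update α i (α i - 1), x), sum_update_pred_le α i, ?_⟩
    exact mul_le_mul_of_nonneg_right (natCast_apply_le_two_pow α i) (by positivity)
  refine ((hf (β + Pi.single i 1)).add h2).mono fun ⟨α, x⟩ => ?_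
  dsimp only
  rw [schwartzPartials_coord, add_apply, smul_apply, schwartzCoord_apply, xpow_add_single,
    abs_mul, pow_one]
  calc _ ≤ |xpow β x| * (‖(x i : ℂ) * schwartzPartials α f x‖ +
        ‖(α i : ℂ) • schwartzPartials (Function.update α i (α i - 1)) f x‖) := by
        gcongr
        exact norm_add_le _ _
    _ = _ := by
        rw [norm_mul, norm_smul, Complex.norm_real, Complex.norm_natCast, Real.norm_eq_abs]
        ring

lemma DerivDominated.monomial {ω : ℝ → ℝ} (hω : IsWeightFn ω) (β : Fin n → ℕ) {f : 𝓢(En n, ℂ)}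
    (hf : DerivDominated ω f) : DerivDominated ω (schwartzMonomial β f) :=
  opPow_induction (fun i _ h => h.coord hω i) β hf

lemma DerivMonomialDominated.derivDominated {ω : ℝ → ℝ} (hω : IsWeightFn ω) {f : 𝓢(En n, ℂ)}
    (hf : DerivMonomialDominated ω f) : DerivDominated ω f := by
  intro β
  induction hm : ∑ i, β i generalizing β f with
  | zero =>
    have hβ : β = 0 := by
      ext i
      exact Finset.sum_eq_zero_iff.1 hm i (Finset.mem_univ i)
    subst hβ
    refine (hf 0).mono fun ⟨α, x⟩ => ?_
    simp [schwartzMonomial_zero, xpow]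
  | succ m ih =>
    obtain ⟨i, hi⟩ : ∃ i, β i ≠ 0 := by
      by_contra! h
      simp [h] at hm
    obtain ⟨γ, rfl⟩ : ∃ γ : Fin n → ℕ, β = γ + Pi.single i 1 := by
      refine ⟨Function.update β i (β i - 1), ?_⟩
      funext j
      by_cases hj : j = i
      · subst hj
        change β j = Function.update β j (β j - 1) j + (Pi.single j 1 : Fin n → ℕ) j
        rw [Function.update_self, Pi.single_eq_same]
        omega
      · change β j = Function.update β i (β i - 1) j + (Pi.single i 1 : Fin n → ℕ) j
        rw [Function.update_of_ne hj, Pi.single_eq_of_ne hj, add_zero]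
    have hγ : ∑ i, γ i = m := by
      simpa [Finset.sum_add_distrib, Finset.sum_pi_single'] using hm
    have hcoord : DerivMonomialDominated ω (schwartzCoord i f) := by
      intro β
      simp_rw [schwartzMonomial_coord]
      exact hf _
    have h2 : DominatedBy ω (fun p : (Fin n → ℕ) × En n => ∑ i, p.1 i) fun p =>
        (p.1 i : ℝ) * (|xpow γ p.2| *
          ‖schwartzPartials (Function.update p.1 i (p.1 i - 1)) f p.2‖) := by
      refine (ih hf γ hγ).of_le hω 2 0 one_le_two fun ⟨α, x⟩ =>
        ⟨(Function.update α i (α i - 1), x), sum_update_pred_le α i, ?_⟩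
      exact mul_le_mul_of_nonneg_right (natCast_apply_le_two_pow α i) (by positivity)
    refine ((ih hcoord γ hγ).add h2).mono fun ⟨α, x⟩ => ?_
    dsimp only
    have h3 : (x i : ℂ) * schwartzPartials α f x = schwartzPartials α (schwartzCoord i f) x -
        (α i : ℂ) • schwartzPartials (Function.update α i (α i - 1)) f x := by
      rw [schwartzPartials_coord, add_apply, smul_apply, schwartzCoord_apply]
      ring
    have h4 := norm_sub_le (schwartzPartials α (schwartzCoord i f) x)
      ((α i : ℂ) • schwartzPartials (Function.update α i (α i - 1)) f x)
    rw [← h3, norm_mul, norm_smul, Complex.norm_real, Complex.norm_natCast,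
      Real.norm_eq_abs] at h4
    rw [xpow_add_single, abs_mul, pow_one]
    calc _ = |xpow γ x| * (|x i| * ‖schwartzPartials α f x‖) := by ring
      _ ≤ |xpow γ x| * (‖schwartzPartials α (schwartzCoord i f) x‖ +
          (α i : ℝ) * ‖schwartzPartials (Function.update α i (α i - 1)) f x‖) := by gcongr
      _ = _ := by ring

lemma DerivDominated.monomialDominated_schwartzFT {ω : ℝ → ℝ} (hω : IsWeightFn ω)
    {f : 𝓢(En n, ℂ)} (hf : DerivDominated ω f) : MonomialDominated ω (schwartzFT f) := by
  intro β
  have hg := hf.monomial hω β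
  obtain ⟨C, hC, hint⟩ := exists_integral_norm_le n
  have hH : DominatedBy ω (fun p : (Fin n → ℕ) × En n => ∑ i, p.1 i) fun p =>
      (1 + ‖p.2‖) ^ (n + 1) * ‖schwartzPartials p.1 (schwartzMonomial β f) p.2‖ := by
    refine DominatedBy.one_add_norm_pow_mul hω (n + 1) (fun _ => norm_nonneg _)
      ((hg 0).mono fun p => ?_) fun k => (hg (Pi.single k (n + 1))).mono fun p => ?_
    · simp [xpow]
    · rw [xpow_single, abs_pow]
  refine hH.of_sup hω C 0 hC fun ⟨α, ξ⟩ M hM => ?_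
  dsimp only
  rw [norm_xpow_mul_schwartzPartials_schwartzFT]
  have h1 := norm_schwartzFT_le (schwartzPartials α (schwartzMonomial β f)) ξ
  have h2 := hint (schwartzPartials α (schwartzMonomial β f)) M fun x => hM (α, x) le_rfl
  refine (ENNReal.ofReal_le_ofReal h1).trans (h2.trans ?_)
  gcongr
  exact le_self_pow₀ hC (Nat.succ_ne_zero _)

lemma derivMonomialDominated_of_schwartzFT {ω : ℝ → ℝ} (hω : IsWeightFn ω)
    {f : 𝓢(En n, ℂ)} (hf : MonomialDominated ω (schwartzFT f)) :
    DerivMonomialDominated ω f := by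
  intro β
  obtain ⟨C, hC, hint⟩ := exists_integral_norm_le n
  have hsingle : ∀ i : Fin n, DominatedBy ω (fun p : (Fin n → ℕ) × En n => ∑ i, p.1 i) fun p =>
      |p.2 i| ^ (n + 1) * (|xpow p.1 p.2| * ‖schwartzPartials β (schwartzFT f) p.2‖) := by
    intro i
    refine (hf β).of_le hω 1 (n + 1) le_rfl fun ⟨α, x⟩ => ⟨(α + Pi.single i (n + 1), x), ?_, ?_⟩
    · simp [Finset.sum_add_distrib, Finset.sum_pi_single']
    · rw [one_pow, one_mul, xpow_add_single, abs_mul, abs_pow]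
      exact le_of_eq (by ring)
  have hH : DominatedBy ω (fun p : (Fin n → ℕ) × En n => ∑ i, p.1 i) fun p =>
      (1 + ‖p.2‖) ^ (n + 1) *
        (|xpow p.1 p.2| * ‖schwartzPartials β (schwartzFT f) p.2‖) :=
    DominatedBy.one_add_norm_pow_mul hω (n + 1) (fun _ => by positivity) (hf β) hsingle
  refine hH.of_sup hω C 0 hC fun ⟨α, x⟩ M hM => ?_
  refine (ENNReal.ofReal_le_ofReal (norm_le_integral_fourier _ x)).trans
    ((hint _ M fun ξ => ?_).trans ?_)
  · refine (ENNReal.ofReal_le_ofReal (norm_fourier_weight_le _ (n + 1) ξ)).trans ?_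
    rw [← norm_xpow_mul_schwartzPartials_schwartzFT]
    exact hM (α, (2 * π) • ξ) le_rfl
  · gcongr
    exact le_self_pow₀ hC (by omega)

lemma derivDominated_iff_schwartzFT {ω : ℝ → ℝ} (hω : IsWeightFn ω) (f : 𝓢(En n, ℂ)) :
    DerivDominated ω f ↔ MonomialDominated ω (schwartzFT f) :=
  ⟨fun h => h.monomialDominated_schwartzFT hω,
    fun h => (derivMonomialDominated_of_schwartzFT hω h).derivDominated hω⟩

lemma norm_Dmulti_coe (α : Fin n → ℕ) (f : 𝓢(En n, ℂ)) (x : En n) :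
    ‖Dmulti α ⇑f x‖ = ‖schwartzPartials α f x‖ := by
  rw [Dmulti, norm_mul, norm_pow, norm_neg, Complex.norm_I, one_pow, one_mul, mpderiv_coe]

lemma decay_iff_monomialDominated {ω : ℝ → ℝ} (hω : IsWeightFn ω) (f : 𝓢(En n, ℂ)) :
    (∀ lam > (0 : ℝ), ∀ α : Fin n → ℕ, ∃ C : ℝ,
      ∀ x, Real.exp (lam * ω ‖x‖) * ‖Dmulti α ⇑f x‖ ≤ C) ↔ MonomialDominated ω f := by
  simp_rw [norm_Dmulti_coe]
  exact ⟨fun h α => dominatedBy_xpow_of_decay hω (fun _ => norm_nonneg _)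
      fun lam hlam => h lam hlam α,
    fun h lam hlam α => decay_of_dominatedBy_xpow hω (fun _ => norm_nonneg _) (h α) lam hlam⟩

theorem statement11 (ω : ℝ → ℝ) (hω : IsWeightFn ω) (u : 𝓢(En n, ℂ)) :
    Cond1 ω u ↔
      ((∀ β : Fin n → ℕ, ∀ lam > (0 : ℝ), ∃ C > (0 : ℝ), ∀ (α : Fin n → ℕ) (x : En n),
          ENNReal.ofReal (|xpow β x| * ‖Dmulti α ⇑u x‖) ≤
            ENNReal.ofReal C * expPhiStar ω lam (∑ i, α i)) ∧
        (∀ α : Fin n → ℕ, ∀ mu > (0 : ℝ), ∃ C > (0 : ℝ), ∀ (β : Fin n → ℕ) (x : En n),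
          ENNReal.ofReal (|xpow β x| * ‖Dmulti α ⇑u x‖) ≤
            ENNReal.ofReal C * expPhiStar ω mu (∑ i, β i))) := by
  rw [Cond1, FTn_coe, decay_iff_monomialDominated hω, decay_iff_monomialDominated hω,
    ← derivDominated_iff_schwartzFT hω, and_comm]
  simp only [DerivDominated, MonomialDominated, DominatedBy, Prod.forall, norm_Dmulti_coe,
    Nat.cast_sum]
end
end
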